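/- arXiv:1009.1939 — 2 statements merged into one kernel-verified Lean document; each statement's English description precedes it below -/
import Mathlib

section
/- In the partition algebra A_k(z) (k ≥ 2): for every i with 1 ≤ i ≤ k−1 one has L_{i+1} p_{i+1/2} = p_{i+1/2} L_{i+1} = p_{i+1/2} L_i p_{i+1} p_{i+1/2}. -/
open Polynomial

/-- Elements of an algebra over `R = ℤ[z]` (with `z = Polynomial.X`) satisfying the
defining relations of the partition algebra `A_k(z)` of Halverson–Ram.
Here `p i` stands for the generator `p_i` (for `1 ≤ i ≤ k`), `q i` stands for the
half-integer generator `p_{i+1/2}` (for `1 ≤ i ≤ k-1`), and `s i` stands for `s_i`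
(for `1 ≤ i ≤ k-1`). -/
structure PartitionAlgebra (k : ℕ) (A : Type*) [Ring A] [Algebra (Polynomial ℤ) A] where
  p : ℕ → A
  q : ℕ → A
  s : ℕ → A
  s_sq : ∀ i, 1 ≤ i → i ≤ k - 1 → s i * s i = 1
  s_comm : ∀ i j, 1 ≤ i → i ≤ k - 1 → 1 ≤ j → j ≤ k - 1 → j ≠ i + 1 → i ≠ j + 1 →
    s i * s j = s j * s i
  braid : ∀ i, 1 ≤ i → i + 1 ≤ k - 1 →
    s i * s (i + 1) * s i = s (i + 1) * s i * s (i + 1)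
  p_sq : ∀ i, 1 ≤ i → i ≤ k → p i * p i = (X : Polynomial ℤ) • p i
  q_sq : ∀ i, 1 ≤ i → i ≤ k - 1 → q i * q i = q i
  s_q : ∀ i, 1 ≤ i → i ≤ k - 1 → s i * q i = q i
  q_s : ∀ i, 1 ≤ i → i ≤ k - 1 → q i * s i = q i
  s_pp : ∀ i, 1 ≤ i → i ≤ k - 1 → s i * (p i * p (i + 1)) = p i * p (i + 1)
  pp_s : ∀ i, 1 ≤ i → i ≤ k - 1 → p i * p (i + 1) * s i = p i * p (i + 1)
  p_comm : ∀ i j, 1 ≤ i → i ≤ k → 1 ≤ j → j ≤ k → p i * p j = p j * p i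
  q_comm : ∀ i j, 1 ≤ i → i ≤ k - 1 → 1 ≤ j → j ≤ k - 1 → q i * q j = q j * q i
  q_p : ∀ i j, 1 ≤ i → i ≤ k - 1 → 1 ≤ j → j ≤ k → j ≠ i → j ≠ i + 1 →
    q i * p j = p j * q i
  s_p : ∀ i j, 1 ≤ i → i ≤ k - 1 → 1 ≤ j → j ≤ k → j ≠ i → j ≠ i + 1 →
    s i * p j = p j * s i
  s_q' : ∀ i j, 1 ≤ i → i ≤ k - 1 → 1 ≤ j → j ≤ k - 1 → j + 1 ≠ i → j ≠ i + 1 →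
    s i * q j = q j * s i
  sps : ∀ i, 1 ≤ i → i ≤ k - 1 → s i * p i * s i = p (i + 1)
  sqs : ∀ i, 2 ≤ i → i ≤ k - 1 →
    s i * q (i - 1) * s i = s (i - 1) * q i * s (i - 1)
  qpq₁ : ∀ i, 1 ≤ i → i ≤ k - 1 → q i * p i * q i = q i
  qpq₂ : ∀ i, 1 ≤ i → i ≤ k - 1 → q i * p (i + 1) * q i = q i
  pqp₁ : ∀ i, 2 ≤ i → i ≤ k → p i * q (i - 1) * p i = p i
  pqp₂ : ∀ i, 1 ≤ i → i ≤ k - 1 → p i * q i * p i = p i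

namespace PartitionAlgebra

variable {k : ℕ} {A : Type*} [Ring A] [Algebra (Polynomial ℤ) A]

/-- `(P.LS i).1 = L_i` and `(P.LS i).2 = σ_i` (with the junk value `σ_0 := 1`). -/
def LS (P : PartitionAlgebra k A) : ℕ → A × A
  | 0 => (0, 1)
  | 1 => (P.p 1, 1)
  | n + 2 =>
    let Lp := (P.LS (n + 1)).1
    let sp := (P.LS (n + 1)).2
    let Lpp := (P.LS n).1
    let snew : A :=
      if n = 0 then P.s 1
      else
        P.s n * P.s (n + 1) * sp * P.s (n + 1) * P.s n
          + P.s (n + 1) * P.q n * Lpp * P.s (n + 1) * P.q n * P.s (n + 1)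
          + P.q n * Lpp * P.s (n + 1) * P.q n
          - P.s (n + 1) * P.q n * Lpp * P.s n * P.q (n + 1) * P.p (n + 1) * P.q n
          - P.q n * P.p (n + 1) * P.q (n + 1) * P.s n * Lpp * P.q n * P.s (n + 1)
    (-(P.s (n + 1) * Lp * P.q (n + 1)) - P.q (n + 1) * Lp * P.s (n + 1)
        + P.q (n + 1) * Lp * P.p (n + 2) * P.q (n + 1)
        + P.s (n + 1) * Lp * P.s (n + 1) + snew,
      snew)

/-- The Jucys–Murphy element `L_i` of the partition algebra. -/
def L (P : PartitionAlgebra k A) (i : ℕ) : A := (P.LS i).1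

/-- The element `σ_i` of the partition algebra. -/
def sig (P : PartitionAlgebra k A) (i : ℕ) : A := (P.LS i).2

/-- `(P.LSh i).1 = L_{i+1/2}` and `(P.LSh i).2 = σ_{i+1/2}`. -/
def LSh (P : PartitionAlgebra k A) : ℕ → A × A
  | 0 => (0, 1)
  | 1 =>
    (-(P.L 1 * P.q 1) - P.q 1 * P.L 1 + P.q 1 * P.L 1 * P.p 1 * P.q 1
        + P.s 1 * (0 : A) * P.s 1 + 1, 1)
  | n + 2 =>
    let Lhp := (P.LSh (n + 1)).1
    let shp := (P.LSh (n + 1)).2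
    let snew : A :=
      P.s (n + 1) * P.s (n + 2) * shp * P.s (n + 2) * P.s (n + 1)
        + P.q (n + 1) * P.L (n + 1) * P.s (n + 2) * P.q (n + 1) * P.s (n + 2)
        + P.s (n + 2) * P.q (n + 1) * P.L (n + 1) * P.s (n + 2) * P.q (n + 1)
        - P.q (n + 1) * P.L (n + 1) * P.s (n + 1) * P.q (n + 2) * P.p (n + 2) * P.q (n + 1)
        - P.s (n + 2) * P.q (n + 1) * P.p (n + 2) * P.q (n + 2) * P.s (n + 1)
            * P.L (n + 1) * P.q (n + 1) * P.s (n + 2)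
    (-(P.L (n + 2) * P.q (n + 2)) - P.q (n + 2) * P.L (n + 2)
        + P.q (n + 2) * P.L (n + 2) * P.p (n + 2) * P.q (n + 2)
        + P.s (n + 2) * Lhp * P.s (n + 2) + snew,
      snew)

/-- The half-integer Jucys–Murphy element `L_{i+1/2}` of the partition algebra. -/
def Lh (P : PartitionAlgebra k A) (i : ℕ) : A := (P.LSh i).1

/-- The element `σ_{i+1/2}` of the partition algebra. -/
def sigH (P : PartitionAlgebra k A) (i : ℕ) : A := (P.LSh i).2

end PartitionAlgebra

namespace PartitionAlgebra

section Words

variable {A : Type*} [Ring A] {s t q r p M σ v w : A}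

theorem mul_eq_reassoc {a b c : A} (h : a * b = c) (x : A) : a * (b * x) = c * x := by
  rw [← h, mul_assoc]

theorem mul_mul_eq_reassoc {a b c d : A} (h : a * b * c = d) (x : A) :
    a * (b * (c * x)) = d * x := by
  simp only [← h, mul_assoc]

theorem mul_mul_of_sqs (htt : t * t = 1) (hsq : s * q = q) (htr : t * r = r)
    (hqr : r * q = q * r) (hsqs : s * r * s = t * q * t) : q * t * q = q * r := by
  calc q * t * q = t * (t * q * t) * q := by simp only [mul_assoc, mul_eq_reassoc htt, one_mul]
    _ = t * s * (r * (s * q)) := by rw [← hsqs]; simp only [mul_assoc]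
    _ = t * (s * q) * r := by simp only [hsq, hqr, mul_assoc, mul_eq_reassoc hsq]
    _ = q * r := by rw [hsq, mul_assoc, ← hqr, ← mul_assoc, htr]

theorem mul_mul_eq_of_sqs (hss : s * s = 1) (htt : t * t = 1) (hsqs : s * r * s = t * q * t) :
    s * t * q = r * s * t := by
  calc s * t * q = s * (t * q * t) * t := by simp only [mul_assoc, htt, mul_one]
    _ = (s * s) * r * s * t := by rw [← hsqs]; simp only [mul_assoc]
    _ = r * s * t := by rw [hss, one_mul]

theorem mul_mul_mul_of_commute (hqr : r * q = q * r) (hqtq : q * t * q = q * r)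
    (hMq : M * q = q * M) : q * t * M * r * q = q * r * M * r := by
  calc q * t * M * r * q = q * t * (M * q) * r := by rw [mul_assoc, hqr]; simp only [mul_assoc]
    _ = q * t * q * M * r := by rw [hMq]; simp only [mul_assoc]
    _ = q * r * M * r := by rw [hqtq]

theorem mul_mul_mul_of_commute' (hqr : r * q = q * r) (hqtq : q * t * q = q * r)
    (hMq : M * q = q * M) : q * r * M * t * q = q * r * M * r := by
  calc q * r * M * t * q = r * (q * M) * t * q := by rw [← hqr]; simp only [mul_assoc]
    _ = r * M * (q * t * q) := by rw [← hMq]; simp only [mul_assoc]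
    _ = r * (M * q) * r := by rw [hqtq]; simp only [mul_assoc]
    _ = q * r * M * r := by rw [hMq, ← hqr]; simp only [mul_assoc]

theorem mul_L_mul (hqr : r * q = q * r)
    (hqtq : q * t * q = q * r) (hqpq : q * p * q = q) (hMq : M * q = q * M) (hMp : M * p = p * M)
    (hqσ : q * σ * q = q * r * M * r) :
    q * (-(t * M * r) - r * M * t + r * M * p * r + t * M * t + σ) * q = q * t * M * t * q := by
  have h : q * r * M * p * r * q = q * r * M * r := by
    calc q * r * M * p * r * q = r * q * (M * p) * (r * q) := by rw [← hqr]; simp only [mul_assoc]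
      _ = r * q * p * (M * q) * r := by rw [hMp, hqr]; simp only [mul_assoc]
      _ = r * (q * p * q) * M * r := by rw [hMq]; simp only [mul_assoc]
      _ = q * r * M * r := by rw [hqpq, hqr]
  simp only [add_mul, sub_mul, mul_add, mul_sub, neg_mul, mul_neg, ← mul_assoc, h, hqσ,
    mul_mul_mul_of_commute hqr hqtq hMq, mul_mul_mul_of_commute' hqr hqtq hMq]
  abel

theorem sig_step_mul (hss : s * s = 1) (htt : t * t = 1) (hsq : s * q = q)
    (hqr : r * q = q * r) (hsqs : s * r * s = t * q * t)
    (hqtq : q * t * q = q * r) (htqr : t * q * r = q * r) (hqpq : q * p * q = q)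
    (hrpr : r * p * r = r) (hMs : M * s = s * M) (hMq : M * q = q * M) (hσr : σ * r = r * M * r) :
    (t * s * σ * s * t + s * r * M * s * r * s + r * M * s * r - s * r * M * t * q * p * r
        - r * p * q * t * M * r * s) * q = q * t * M * t * q := by
  have hstq := mul_mul_eq_of_sqs hss htt hsqs
  have htsr := mul_mul_eq_of_sqs htt hss hsqs.symm
  have h₁ : t * s * σ * s * t * q = q * t * M * t * q := by
    calc t * s * σ * s * t * q = t * s * σ * (s * t * q) := by simp only [mul_assoc]
      _ = t * s * (σ * r) * (s * t) := by rw [hstq]; simp only [mul_assoc]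
      _ = (t * s * r) * (M * (r * s * t)) := by rw [hσr]; simp only [mul_assoc]
      _ = q * t * s * (M * s) * t * q := by rw [htsr, ← hstq]; simp only [mul_assoc]
      _ = q * t * (s * s) * M * t * q := by rw [hMs]; simp only [mul_assoc]
      _ = q * t * M * t * q := by rw [hss, mul_one]
  have hrpqr : r * p * q * r = q * r := by
    rw [mul_assoc, ← hqr, ← mul_assoc, hrpr]
  have hrpqr' (x : A) : r * (p * (q * (r * x))) = q * (r * x) := by
    simpa only [mul_assoc] using congrArg (· * x) hrpqr
  have hqpq' := mul_mul_eq_reassoc hqpq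
  have hqtq' := mul_mul_eq_reassoc hqtq
  simp only [mul_assoc] at h₁ htqr
  simp only [add_mul, sub_mul, mul_assoc, mul_eq_reassoc hsq, hsq, mul_eq_reassoc hqr, hqr,
    mul_eq_reassoc hMq, hqtq', hqpq', htqr, hrpqr', h₁]
  abel

theorem mul_sig_step_mul (hss : s * s = 1) (htt : t * t = 1) (hqq : q * q = q) (hrt : r * t = r)
    (hqr : r * q = q * r) (hsqs : s * r * s = t * q * t)
    (hqtq : q * t * q = q * r) (hrpr : r * p * r = r) (hMs : M * s = s * M) (hMq : M * q = q * M)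
    (hqσ : q * σ * q = q * r * M * r)
    (hvv : v * v = 1) (hvq : v * q * v = s * w * s) (hvr : Commute v r) (hvM : Commute v M)
    (hvσ : Commute v σ) (hww : w * w = w) (hwsw : w * s * w = w * q) (hwt : Commute w t)
    (hwr : Commute w r) (hwq : Commute w q) (hwp : Commute w p) (hwM : Commute w M) :
    w * (t * s * σ * s * t + s * r * M * s * r * s + r * M * s * r - s * r * M * t * q * p * r
        - r * p * q * t * M * r * s) * w = w * (q * t * M * t * q) := by
  have hstq := mul_mul_eq_of_sqs hss htt hsqs
  have htsr := mul_mul_eq_of_sqs htt hss hsqs.symm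
  have hqσ' : q * σ * q = q * (r * M * r) * q := by
    calc q * σ * q = (q * σ * q) * q := by rw [mul_assoc _ q q, hqq]
      _ = q * (r * M * r) * q := by rw [hqσ]; simp only [mul_assoc]
  have hconj {x : A} (hx : Commute v x) : w * (s * x * s) * w = s * v * (q * x * q) * v * s := by
    have hvxv : x = v * x * v := by rw [hx.eq, mul_assoc, hvv, mul_one]
    calc w * (s * x * s) * w = s * (s * w * s) * x * (s * w * s) * s := by
          simp only [mul_assoc, mul_eq_reassoc hss, hss, one_mul, mul_one]
      _ = s * v * (q * (v * x * v) * q) * v * s := by rw [← hvq]; simp only [mul_assoc]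
      _ = s * v * (q * x * q) * v * s := by rw [← hvxv]
  have h₁ : w * (t * s * σ * s * t) * w = w * (q * t * M * t * q) := by
    calc w * (t * s * σ * s * t) * w = (w * t) * s * σ * s * (t * w) := by simp only [mul_assoc]
      _ = t * (w * (s * σ * s) * w) * t := by
          rw [hwt.eq]; simp only [mul_assoc, hwt.eq]
      _ = t * (w * (s * (r * M * r) * s) * w) * t := by
          rw [hconj hvσ, hqσ', hconj ((hvr.mul_right hvM).mul_right hvr)]
      _ = (t * w) * s * (r * M * r) * s * (w * t) := by simp only [mul_assoc]
      _ = w * (t * s * r) * M * (r * s * t) * w := by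
          simp only [mul_assoc, mul_eq_reassoc hwt.eq, hwt.eq]
      _ = w * q * t * s * (M * s) * t * (q * w) := by rw [htsr, ← hstq]; simp only [mul_assoc]
      _ = w * q * t * (s * s) * M * t * w * q := by rw [hMs, ← hwq.eq]; simp only [mul_assoc]
      _ = w * (q * t * M * t) * w * q := by rw [hss]; simp only [mul_assoc, one_mul]
      _ = w * (q * t * M * t * q) := by
          rw [(((hwq.mul_right hwt).mul_right hwM).mul_right hwt).eq, mul_assoc _ w w, hww,
            ← (((hwq.mul_right hwt).mul_right hwM).mul_right hwt).eq, mul_assoc]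
  have hl {x : A} (hx : Commute w x) : w * (s * x) * w = w * q * x := by
    rw [mul_assoc, mul_assoc, ← hx.eq, ← mul_assoc, ← mul_assoc, hwsw]
  have hr {x : A} (hx : Commute w x) : w * (x * s) * w = w * x * q := by
    rw [← mul_assoc, hx.eq, mul_assoc, mul_assoc, ← mul_assoc w, hwsw, ← mul_assoc, ← hx.eq]
  have hrMq : r * M * q = q * r * M := by
    rw [mul_assoc, hMq, ← mul_assoc, hqr]
  have h₃ : w * (r * M * s * r) * w = w * (q * r * M * r) := by
    calc w * (r * M * s * r) * w = w * (r * M * s) * (r * w) := by simp only [mul_assoc]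
      _ = w * (r * M * s) * w * r := by rw [← hwr.eq]; simp only [mul_assoc]
      _ = w * (r * M * q) * r := by rw [hr (hwr.mul_right hwM)]; simp only [mul_assoc]
      _ = w * (q * r * M * r) := by rw [hrMq]; simp only [mul_assoc]
  have h₂ : w * (s * r * M * s * r * s) * w = w * (q * r * M * r) := by
    have hx : Commute w (r * M * t * q * t) :=
      (((hwr.mul_right hwM).mul_right hwt).mul_right hwq).mul_right hwt
    calc w * (s * r * M * s * r * s) * w = w * (s * (r * M * (s * r * s))) * w := by
          simp only [mul_assoc]
      _ = w * (s * (r * M * t * q * t)) * w := by rw [hsqs]; simp only [mul_assoc]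
      _ = w * (q * r * M * t * q) * t := by rw [hl hx]; simp only [mul_assoc]
      _ = w * q * r * M * (r * t) := by
          rw [mul_mul_mul_of_commute' hqr hqtq hMq]; simp only [mul_assoc]
      _ = w * (q * r * M * r) := by rw [hrt]; simp only [mul_assoc]
  have h₄ : w * (s * r * M * t * q * p * r) * w = w * (q * r * M * r) := by
    have hx : Commute w (r * M * t * q * p * r) :=
      ((((hwr.mul_right hwM).mul_right hwt).mul_right hwq).mul_right hwp).mul_right hwr
    calc w * (s * r * M * t * q * p * r) * w = w * (s * (r * M * t * q * p * r)) * w := by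
          simp only [mul_assoc]
      _ = w * (q * r * M * t * q) * p * r := by rw [hl hx]; simp only [mul_assoc]
      _ = w * q * r * M * (r * p * r) := by
          rw [mul_mul_mul_of_commute' hqr hqtq hMq]; simp only [mul_assoc]
      _ = w * (q * r * M * r) := by rw [hrpr]; simp only [mul_assoc]
  have h₅ : w * (r * p * q * t * M * r * s) * w = w * (q * r * M * r) := by
    have hx : Commute w (r * p * q * t * M * r) :=
      ((((hwr.mul_right hwp).mul_right hwq).mul_right hwt).mul_right hwM).mul_right hwr
    calc w * (r * p * q * t * M * r * s) * w = w * r * p * (q * t) * M * (r * q) := by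
          rw [hr hx]; simp only [mul_assoc]
      _ = w * r * p * q * t * (M * q) * r := by rw [hqr]; simp only [mul_assoc]
      _ = w * r * p * (q * t * q) * M * r := by rw [hMq]; simp only [mul_assoc]
      _ = w * (r * p * r) * q * M * r := by rw [hqtq, ← hqr]; simp only [mul_assoc]
      _ = w * (q * r * M * r) := by rw [hrpr, mul_assoc w, hqr]; simp only [mul_assoc]
  simp only [mul_add, mul_sub, add_mul, sub_mul, h₁, h₂, h₃, h₄, h₅]
  abel

end Words
variable {k : ℕ} {A : Type*} [Ring A] [Algebra (Polynomial ℤ) A] (P : PartitionAlgebra k A)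

theorem L_one : P.L 1 = P.p 1 := rfl

theorem sig_two : P.sig 2 = P.s 1 := rfl

theorem L_add_two (n : ℕ) :
    P.L (n + 2) = -(P.s (n + 1) * P.L (n + 1) * P.q (n + 1))
      - P.q (n + 1) * P.L (n + 1) * P.s (n + 1)
      + P.q (n + 1) * P.L (n + 1) * P.p (n + 2) * P.q (n + 1)
      + P.s (n + 1) * P.L (n + 1) * P.s (n + 1) + P.sig (n + 2) := rfl

theorem sig_add_three (n : ℕ) :
    P.sig (n + 3) = P.s (n + 1) * P.s (n + 2) * P.sig (n + 2) * P.s (n + 2) * P.s (n + 1)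
      + P.s (n + 2) * P.q (n + 1) * P.L (n + 1) * P.s (n + 2) * P.q (n + 1) * P.s (n + 2)
      + P.q (n + 1) * P.L (n + 1) * P.s (n + 2) * P.q (n + 1)
      - P.s (n + 2) * P.q (n + 1) * P.L (n + 1) * P.s (n + 1) * P.q (n + 2) * P.p (n + 2)
        * P.q (n + 1)
      - P.q (n + 1) * P.p (n + 2) * P.q (n + 2) * P.s (n + 1) * P.L (n + 1) * P.q (n + 1)
        * P.s (n + 2) := rfl

theorem commute_L_and_sig {x : A} (n : ℕ) (hs : ∀ j, 1 ≤ j → j < n → Commute x (P.s j))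
    (hq : ∀ j, 1 ≤ j → j < n → Commute x (P.q j)) (hp : ∀ j, 1 ≤ j → j ≤ n → Commute x (P.p j)) :
    Commute x (P.L n) ∧ Commute x (P.sig n) := by
  induction n using Nat.strong_induction_on with
  | _ n ih =>
    match n, ih, hs, hq, hp with
    | 0, _, _, _, _ => exact ⟨Commute.zero_right x, Commute.one_right x⟩
    | 1, _, _, _, hp => exact ⟨hp 1 le_rfl le_rfl, Commute.one_right x⟩
    | n + 2, ih, hs, hq, hp =>
      have h₁ := ih (n + 1) (by omega) (fun j h h' => hs j h (by omega))
        (fun j h h' => hq j h (by omega)) (fun j h h' => hp j h (by omega))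
      have hs₁ := hs (n + 1) (by omega) (by omega)
      have hq₁ := hq (n + 1) (by omega) (by omega)
      have hp₁ := hp (n + 2) (by omega) le_rfl
      have hσ : Commute x (P.sig (n + 2)) := by
        match n, ih, h₁, hs, hq, hp, hs₁, hq₁, hp₁ with
        | 0, _, _, _, _, _, hs₁, _, _ => exact hs₁
        | n + 1, ih, h₁, hs, hq, hp, hs₁, hq₁, _ =>
          have hL := (ih (n + 1) (by omega) (fun j h h' => hs j h (by omega))
            (fun j h h' => hq j h (by omega)) (fun j h h' => hp j h (by omega))).1
          have hs₀ := hs (n + 1) (by omega) (by omega)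
          have hq₀ := hq (n + 1) (by omega) (by omega)
          have hp₀ := hp (n + 2) (by omega) (by omega)
          have hσ := h₁.2
          rw [sig_add_three]
          repeat' first
            | assumption
            | apply Commute.add_right
            | apply Commute.sub_right
            | apply Commute.mul_right
      refine ⟨?_, hσ⟩
      have hL := h₁.1
      rw [L_add_two]
      repeat' first
        | assumption
        | apply Commute.add_right
        | apply Commute.sub_right
        | apply Commute.neg_right
        | apply Commute.mul_right

theorem commute_s_L_and_sig {m n : ℕ} (hnm : n < m) (hm : m ≤ k - 1) :
    Commute (P.s m) (P.L n) ∧ Commute (P.s m) (P.sig n) :=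
  P.commute_L_and_sig n
    (fun j h h' => P.s_comm m j (by omega) hm h (by omega) (by omega) (by omega))
    (fun j h h' => P.s_q' m j (by omega) hm h (by omega) (by omega) (by omega))
    (fun j h h' => P.s_p m j (by omega) hm h (by omega) (by omega) (by omega))

theorem commute_q_L_and_sig {m n : ℕ} (hnm : n < m) (hm : m ≤ k - 1) :
    Commute (P.q m) (P.L n) ∧ Commute (P.q m) (P.sig n) :=
  P.commute_L_and_sig n
    (fun j h h' => (P.s_q' j m h (by omega) (by omega) hm (by omega) (by omega)).symm)
    (fun j h h' => P.q_comm m j (by omega) hm h (by omega))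
    (fun j h h' => P.q_p m j (by omega) hm h (by omega) (by omega) (by omega))

theorem commute_p_L {m n : ℕ} (hnm : n < m) (hm : m ≤ k) : Commute (P.p m) (P.L n) :=
  (P.commute_L_and_sig n
    (fun j h h' => (P.s_p j m h (by omega) (by omega) hm (by omega) (by omega)).symm)
    (fun j h h' => (P.q_p j m h (by omega) (by omega) hm (by omega) (by omega)).symm)
    (fun j h h' => P.p_comm m j (by omega) hm h (by omega))).1

theorem q_s_pred_q {n : ℕ} (hn : n + 2 ≤ k - 1) :
    P.q (n + 2) * P.s (n + 1) * P.q (n + 2) = P.q (n + 2) * P.q (n + 1) :=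
  mul_mul_of_sqs (P.s_sq _ (by omega) (by omega)) (P.s_q _ (by omega) hn)
    (P.s_q _ (by omega) (by omega)) (P.q_comm _ _ (by omega) (by omega) (by omega) hn)
    (P.sqs _ (by omega) hn)

theorem q_L_q {n : ℕ} (hn : n + 2 ≤ k - 1)
    (hσ : P.q (n + 2) * P.sig (n + 2) * P.q (n + 2)
      = P.q (n + 2) * P.q (n + 1) * P.L (n + 1) * P.q (n + 1)) :
    P.q (n + 2) * P.L (n + 2) * P.q (n + 2)
      = P.q (n + 2) * P.s (n + 1) * P.L (n + 1) * P.s (n + 1) * P.q (n + 2) := by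
  rw [L_add_two]
  exact mul_L_mul (P.q_comm _ _ (by omega) (by omega) (by omega) hn) (P.q_s_pred_q hn)
    (P.qpq₁ _ (by omega) hn) (P.commute_q_L_and_sig (by omega) hn).1.symm.eq
    (P.commute_p_L (by omega) (by omega)).symm.eq hσ

theorem q_sig_q (n : ℕ) (hn : n + 2 ≤ k - 1) :
    P.q (n + 2) * P.sig (n + 2) * P.q (n + 2)
      = P.q (n + 2) * P.q (n + 1) * P.L (n + 1) * P.q (n + 1) := by
  induction n with
  | zero =>
    rw [sig_two, P.q_s_pred_q hn, mul_assoc, mul_assoc, ← mul_assoc (P.q _) (P.L _), zero_add,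
      L_one, P.qpq₁ 1 le_rfl (by omega)]
  | succ n ih =>
    have ih := ih (by omega)
    rw [mul_assoc (P.q _) (P.q _), mul_assoc (P.q _) (P.q _ * _), P.q_L_q (by omega) ih,
      sig_add_three]
    exact mul_sig_step_mul (P.s_sq _ (by omega) (by omega)) (P.s_sq _ (by omega) (by omega))
      (P.q_sq _ (by omega) (by omega)) (P.q_s _ (by omega) (by omega))
      (P.q_comm _ _ (by omega) (by omega) (by omega) (by omega))
      (P.sqs _ (by omega) (by omega)) (P.q_s_pred_q (by omega)) (P.qpq₂ _ (by omega) (by omega))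
      (P.commute_s_L_and_sig (by omega) (by omega)).1.symm.eq
      (P.commute_q_L_and_sig (by omega) (by omega)).1.symm.eq ih
      (P.s_sq (n + 3) (by omega) hn) (P.sqs (n + 3) (by omega) hn)
      (P.s_q' _ _ (by omega) hn (by omega) (by omega) (by omega) (by omega))
      (P.commute_s_L_and_sig (by omega) hn).1 (P.commute_s_L_and_sig (by omega) hn).2
      (P.q_sq _ (by omega) hn) (P.q_s_pred_q hn)
      (P.s_q' _ _ (by omega) (by omega) (by omega) hn (by omega) (by omega)).symm
      (P.q_comm _ _ (by omega) hn (by omega) (by omega))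
      (P.q_comm _ _ (by omega) hn (by omega) (by omega))
      (P.q_p _ _ (by omega) hn (by omega) (by omega) (by omega) (by omega))
      (P.commute_q_L_and_sig (by omega) hn).1

theorem sig_q (n : ℕ) (hn : n + 1 ≤ k - 1) :
    P.sig (n + 2) * P.q (n + 1) = P.q (n + 1) * P.L (n + 1) * P.q (n + 1) := by
  induction n with
  | zero => rw [sig_two, zero_add, L_one, P.qpq₁ 1 le_rfl hn, P.s_q 1 le_rfl hn]
  | succ n ih =>
    have hqr := P.q_comm (n + 1) (n + 2) (by omega) (by omega) (by omega) hn
    rw [P.q_L_q hn (P.q_sig_q n hn), sig_add_three]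
    refine sig_step_mul (P.s_sq _ (by omega) hn) (P.s_sq _ (by omega) (by omega))
      (P.s_q _ (by omega) hn) hqr (P.sqs _ (by omega) hn) (P.q_s_pred_q hn) ?_
      (P.qpq₁ _ (by omega) hn) (P.qpq₂ _ (by omega) (by omega))
      (P.commute_s_L_and_sig (by omega) hn).1.symm.eq
      (P.commute_q_L_and_sig (by omega) hn).1.symm.eq (ih (by omega))
    rw [mul_assoc, ← hqr, ← mul_assoc, P.s_q _ (by omega) (by omega)]

open MulOpposite in
/-- The defining relations of the partition algebra are invariant under reversal of products. -/
def op : PartitionAlgebra k Aᵐᵒᵖ where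
  p i := MulOpposite.op (P.p i)
  q i := MulOpposite.op (P.q i)
  s i := MulOpposite.op (P.s i)
  s_sq i h h' := unop_injective (P.s_sq i h h')
  s_comm i j h h' g g' d d' := unop_injective (P.s_comm i j h h' g g' d d').symm
  braid i h h' := unop_injective (by simpa [mul_assoc] using P.braid i h h')
  p_sq i h h' := unop_injective (P.p_sq i h h')
  q_sq i h h' := unop_injective (P.q_sq i h h')
  s_q i h h' := unop_injective (P.q_s i h h')
  q_s i h h' := unop_injective (P.s_q i h h')
  s_pp i h h' := unop_injective (by
    simpa [P.p_comm (i + 1) i (by omega) (by omega) h (by omega)] using P.pp_s i h h')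
  pp_s i h h' := unop_injective (by
    simpa [P.p_comm (i + 1) i (by omega) (by omega) h (by omega)] using P.s_pp i h h')
  p_comm i j h h' g g' := unop_injective (P.p_comm i j h h' g g').symm
  q_comm i j h h' g g' := unop_injective (P.q_comm i j h h' g g').symm
  q_p i j h h' g g' d d' := unop_injective (P.q_p i j h h' g g' d d').symm
  s_p i j h h' g g' d d' := unop_injective (P.s_p i j h h' g g' d d').symm
  s_q' i j h h' g g' d d' := unop_injective (P.s_q' i j h h' g g' d d').symm
  sps i h h' := unop_injective (by simpa [mul_assoc] using P.sps i h h')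
  sqs i h h' := unop_injective (by simpa [mul_assoc] using P.sqs i h h')
  qpq₁ i h h' := unop_injective (by simpa [mul_assoc] using P.qpq₁ i h h')
  qpq₂ i h h' := unop_injective (by simpa [mul_assoc] using P.qpq₂ i h h')
  pqp₁ i h h' := unop_injective (by simpa [mul_assoc] using P.pqp₁ i h h')
  pqp₂ i h h' := unop_injective (by simpa [mul_assoc] using P.pqp₂ i h h')

theorem L_and_sig_op (n : ℕ) (hn : n ≤ k) :
    P.op.L n = MulOpposite.op (P.L n) ∧ P.op.sig n = MulOpposite.op (P.sig n) := by
  induction n using Nat.strong_induction_on with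
  | _ n ih =>
    match n, ih, hn with
    | 0, _, _ => exact ⟨rfl, rfl⟩
    | 1, _, _ => exact ⟨rfl, rfl⟩
    | n + 2, ih, hn =>
      have h₁ := ih (n + 1) (by omega) (by omega)
      have hσ : P.op.sig (n + 2) = MulOpposite.op (P.sig (n + 2)) := by
        match n, ih, h₁, hn with
        | 0, _, _, _ => rfl
        | n + 1, ih, h₁, hn =>
          have hL := (ih (n + 1) (by omega) (by omega)).1
          have hsL := (P.commute_s_L_and_sig (m := n + 2) (n := n + 1) (by omega) (by omega)).1
          rw [sig_add_three, sig_add_three, hL, h₁.2]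
          apply MulOpposite.unop_injective
          simp only [op, MulOpposite.unop_add, MulOpposite.unop_sub, MulOpposite.unop_mul,
            MulOpposite.unop_op, mul_assoc, mul_eq_reassoc hsL.eq]
          abel
      refine ⟨?_, hσ⟩
      have hpL := P.commute_p_L (m := n + 2) (n := n + 1) (by omega) hn
      rw [L_add_two, L_add_two, h₁.1, hσ]
      apply MulOpposite.unop_injective
      simp only [op, MulOpposite.unop_add, MulOpposite.unop_sub, MulOpposite.unop_neg,
        MulOpposite.unop_mul, MulOpposite.unop_op, mul_assoc, mul_eq_reassoc hpL.eq]
      abel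

theorem q_sig (n : ℕ) (hn : n + 1 ≤ k - 1) :
    P.q (n + 1) * P.sig (n + 2) = P.q (n + 1) * P.L (n + 1) * P.q (n + 1) := by
  have h := P.op.sig_q n hn
  rw [(P.L_and_sig_op (n + 1) (by omega)).1, (P.L_and_sig_op (n + 2) (by omega)).2] at h
  simpa [op, mul_assoc] using congrArg MulOpposite.unop h

theorem L_mul_q (n : ℕ) (hn : n + 1 ≤ k - 1) :
    P.L (n + 2) * P.q (n + 1) = P.q (n + 1) * P.L (n + 1) * P.p (n + 2) * P.q (n + 1) := by
  simp only [L_add_two, add_mul, sub_mul, neg_mul, mul_assoc, P.sig_q n hn,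
    P.q_sq (n + 1) (by omega) hn, P.s_q (n + 1) (by omega) hn]
  abel

theorem q_mul_L (n : ℕ) (hn : n + 1 ≤ k - 1) :
    P.q (n + 1) * P.L (n + 2) = P.q (n + 1) * P.L (n + 1) * P.p (n + 2) * P.q (n + 1) := by
  simp only [L_add_two, mul_add, mul_sub, mul_neg, ← mul_assoc, P.q_sig n hn,
    P.q_sq (n + 1) (by omega) hn, P.q_s (n + 1) (by omega) hn]
  abel

end PartitionAlgebra

/-- Theorem 3.7(1): `L_{i+1} p_{i+1/2} = p_{i+1/2} L_{i+1} = p_{i+1/2} L_i p_{i+1} p_{i+1/2}`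
for `1 ≤ i ≤ k-1`. -/
theorem partitionAlgebra_L_q {k : ℕ} (hk : 2 ≤ k) {A : Type*} [Ring A]
    [Algebra (Polynomial ℤ) A] (P : PartitionAlgebra k A) :
    ∀ i, 1 ≤ i → i ≤ k - 1 →
      P.L (i + 1) * P.q i = P.q i * P.L (i + 1) ∧
      P.q i * P.L (i + 1) = P.q i * P.L i * P.p (i + 1) * P.q i := by
  intro i hi hik
  obtain ⟨n, rfl⟩ := Nat.exists_eq_add_of_le' hi
  exact ⟨(P.L_mul_q n hik).trans (P.q_mul_L n hik).symm, P.q_mul_L n hik⟩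
end

section
/- In the partition algebra A_k(z): the element L_{i+1} commutes with p_i for every i with 1 ≤ i ≤ k−1, and L_{i+1} commutes with each of p_{i−1/2}, s_{i−1}, and p_{i−1} for every i with 2 ≤ i ≤ k−1. -/
open Polynomial

/-- Conjugation by an involution, as a monoid homomorphism. -/
def involutionConj {M : Type*} [Monoid M] (s : M) (h : s * s = 1) : M →* M where
  toFun x := s * x * s
  map_one' := by simp [h]
  map_mul' x y := by
    calc s * (x * y) * s = s * x * 1 * y * s := by simp only [mul_assoc, mul_one]
      _ = s * x * s * (s * y * s) := by rw [← h]; simp only [mul_assoc]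

lemma involutionConj_eq {M : Type*} [Monoid M] {s x y : M} (h : s * s = 1)
    (hx : s * x = y * s) : involutionConj s h x = y := by
  change s * x * s = y
  rw [hx, mul_assoc, h, mul_one]

lemma eq_of_forall_mul_eq {M : Type*} [Monoid M] {x y : M} (h : ∀ z, x * z = y * z) : x = y := by
  simpa only [mul_one] using h 1

/-- Elements of a monoid behaving like the generators of the partition algebra on three
strands, together with transpositions `t`. The strands are labelled by `Fin 3`; the elements
`q c`, `s c` and `t c` are attached to the pair of strands `a`, `b` different from `c`. -/
structure ThreeStrands {M : Type*} [Monoid M] (p q s t : Fin 3 → M) : Prop where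
  s_mul_s : ∀ a, s a * s a = 1
  s_mul_p : ∀ a b, s a * p b = p (-a - b) * s a
  s_mul_q : ∀ a b, s a * q b = q (-a - b) * s a
  s_mul_s' : ∀ a b, s a * s b = s (-a - b) * s a
  s_mul_t : ∀ a b, s a * t b = t (-a - b) * s a
  p_comm : ∀ a b, p a * p b = p b * p a
  q_comm : ∀ a b, q a * q b = q b * q a
  q_p_comm : ∀ a, q a * p a = p a * q a
  t_p_comm : ∀ a, t a * p a = p a * t a
  t_q_comm : ∀ a b, t a * q b = q b * t a
  s_mul_q_self : ∀ a, s a * q a = q a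
  q_mul_q : ∀ a, q a * q a = q a
  t_mul_q : ∀ a, t a * q a = q a
  p_q_p : ∀ a b, a ≠ b → p a * q b * p a = p a
  q_p_q : ∀ a b, a ≠ b → q a * p b * q a = q a

namespace ThreeStrands

section Build

variable {M : Type*} [Monoid M]

lemma conj_of_base {s x : Fin 3 → M} (h0 : s 0 * s 0 = 1) (h2 : s 2 * s 2 = 1)
    (h1 : s 1 = s 2 * s 0 * s 2) (h22 : s 2 * x 2 = x 2 * s 2) (h20 : s 2 * x 0 = x 1 * s 2)
    (h00 : s 0 * x 0 = x 0 * s 0) (h02 : s 0 * x 2 = x 1 * s 0) (a b : Fin 3) :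
    s a * x b = x (-a - b) * s a := by
  have h21 : s 2 * x 1 = x 0 * s 2 := by
    calc s 2 * x 1 = s 2 * (x 1 * s 2) * s 2 := by simp only [mul_assoc, h2, mul_one]
      _ = x 0 * s 2 := by rw [← h20, ← mul_assoc, h2, one_mul]
  have h01 : s 0 * x 1 = x 2 * s 0 := by
    calc s 0 * x 1 = s 0 * (x 1 * s 0) * s 0 := by simp only [mul_assoc, h0, mul_one]
      _ = x 2 * s 0 := by rw [← h02, ← mul_assoc, h0, one_mul]
  have e2 : ∀ b, s 2 * x b = x (-2 - b) * s 2 := by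
    intro b; fin_cases b
    exacts [h20, h21, h22]
  have e0 : ∀ b, s 0 * x b = x (-0 - b) * s 0 := by
    intro b; fin_cases b
    exacts [h00, h01, h02]
  have e1 : ∀ b, s 1 * x b = x (-2 - (-0 - (-2 - b))) * s 1 := by
    intro b
    simp only [h1, mul_assoc]
    rw [e2, ← mul_assoc (s 0), e0, ← mul_assoc (s 2), ← mul_assoc (s 2), e2]
    simp only [mul_assoc]
  fin_cases a
  · exact e0 b
  · have : (-2 - (-0 - (-2 - b)) : Fin 3) = -1 - b := by revert b; decide
    have := this ▸ e1 b
    exact this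
  · exact e2 b

lemma forall_of_conj {Q : Fin 3 → Prop} (h : Q 2) (hc : ∀ c a, Q a → Q (-c - a)) (a : Fin 3) :
    Q a := by
  fin_cases a
  exacts [hc 1 2 h, hc 0 2 h, h]

lemma forall_ne_of_conj {Q : Fin 3 → Fin 3 → Prop} (h : Q 2 0)
    (hc : ∀ c a b, Q a b → Q (-c - a) (-c - b)) (a b : Fin 3) (hab : a ≠ b) : Q a b := by
  have h12 : Q 1 0 := hc 0 2 0 h
  have h21 : Q 2 1 := hc 2 2 0 h
  have h02 : Q 0 2 := hc 1 2 0 h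
  have h01 : Q 0 1 := hc 2 1 0 h12
  have h10 : Q 1 2 := hc 0 2 1 h21
  revert hab
  fin_cases a <;> fin_cases b <;> intro hab <;> first | assumption | exact absurd rfl hab

/-- The three strand relations follow from those for one pair of strands by conjugation. -/
lemma of_base {p q s t : Fin 3 → M} (h0 : s 0 * s 0 = 1) (h2 : s 2 * s 2 = 1)
    (h1 : s 1 = s 2 * s 0 * s 2) (braid : s 2 * s 0 * s 2 = s 0 * s 2 * s 0)
    (p1 : p 1 = s 2 * p 0 * s 2) (p2 : p 2 = s 0 * p 1 * s 0)
    (s0p0 : s 0 * p 0 = p 0 * s 0) (s2p2 : s 2 * p 2 = p 2 * s 2)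
    (s2q2 : s 2 * q 2 = q 2) (q2s2 : q 2 * s 2 = q 2) (s0q0 : s 0 * q 0 = q 0)
    (q0s0 : q 0 * s 0 = q 0) (q1 : q 1 = s 0 * q 2 * s 0) (q1' : q 1 = s 2 * q 0 * s 2)
    (s2t2 : s 2 * t 2 = t 2 * s 2) (t1 : t 1 = s 0 * t 2 * s 0) (t0 : t 0 = s 2 * t 1 * s 2)
    (p_comm : ∀ a b, p a * p b = p b * p a) (q_comm : q 2 * q 0 = q 0 * q 2)
    (q_p_comm : q 2 * p 2 = p 2 * q 2) (t_p_comm : t 2 * p 2 = p 2 * t 2)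
    (t_q_comm : t 2 * q 0 = q 0 * t 2) (q2q2 : q 2 * q 2 = q 2)
    (t2q2 : t 2 * q 2 = q 2) (q2t2 : q 2 * t 2 = q 2)
    (p_q_p : p 0 * q 2 * p 0 = p 0) (q_p_q : q 2 * p 0 * q 2 = q 2) :
    ThreeStrands p q s t := by
  have cancel0 : ∀ x, s 0 * (s 0 * x) = x := fun x => by rw [← mul_assoc, h0, one_mul]
  have cancel2 : ∀ x, s 2 * (s 2 * x) = x := fun x => by rw [← mul_assoc, h2, one_mul]
  have hp := conj_of_base (x := p) h0 h2 h1 s2p2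
    (by rw [p1]; simp only [mul_assoc, h2, mul_one]) s0p0
    (by rw [p2]; simp only [mul_assoc, cancel0])
  have hq := conj_of_base (x := q) h0 h2 h1 (s2q2.trans q2s2.symm)
    (by rw [q1']; simp only [mul_assoc, h2, mul_one]) (s0q0.trans q0s0.symm)
    (by rw [q1]; simp only [mul_assoc, h0, mul_one])
  have hs := conj_of_base (x := s) h0 h2 h1 rfl
    (by rw [h1]; simp only [mul_assoc, h2, mul_one]) rfl
    (by rw [h1, braid]; simp only [mul_assoc, h0, mul_one])
  have ht := conj_of_base (x := t) h0 h2 h1 s2t2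
    (by rw [t0]; simp only [mul_assoc, cancel2])
    (by
      have braid' : ∀ x, s 0 * (s 2 * (s 0 * x)) = s 2 * (s 0 * (s 2 * x)) := fun x => by
        simpa only [mul_assoc] using congrArg (· * x) braid.symm
      have s2t2' : ∀ x, s 2 * (t 2 * x) = t 2 * (s 2 * x) := fun x => by
        simpa only [mul_assoc] using congrArg (· * x) s2t2
      rw [t0, t1]
      simp only [mul_assoc]
      rw [braid', s2t2']
      simp only [mul_assoc] at braid
      rw [braid])
    (by rw [t1]; simp only [mul_assoc, h0, mul_one])
  have hss : ∀ a, s a * s a = 1 := by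
    intro a
    fin_cases a
    · exact h0
    · change s 1 * s 1 = 1
      rw [h1]
      simp only [mul_assoc, cancel2, cancel0, h2]
    · exact h2
  have fp c b : involutionConj (s c) (hss c) (p b) = p (-c - b) := involutionConj_eq _ (hp c b)
  have fq c b : involutionConj (s c) (hss c) (q b) = q (-c - b) := involutionConj_eq _ (hq c b)
  have fs c b : involutionConj (s c) (hss c) (s b) = s (-c - b) := involutionConj_eq _ (hs c b)
  have ft c b : involutionConj (s c) (hss c) (t b) = t (-c - b) := involutionConj_eq _ (ht c b)
  have sq : ∀ a, s a * q a = q a := forall_of_conj s2q2 fun c a h => by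
    simpa only [map_mul, fs, fq] using congrArg (involutionConj (s c) (hss c)) h
  have qq : ∀ a, q a * q a = q a := forall_of_conj q2q2 fun c a h => by
    simpa only [map_mul, fq] using congrArg (involutionConj (s c) (hss c)) h
  have tq : ∀ a, t a * q a = q a := forall_of_conj t2q2 fun c a h => by
    simpa only [map_mul, ft, fq] using congrArg (involutionConj (s c) (hss c)) h
  have qt : ∀ a, q a * t a = q a := forall_of_conj q2t2 fun c a h => by
    simpa only [map_mul, ft, fq] using congrArg (involutionConj (s c) (hss c)) h
  refine ⟨hss, hp, hq, hs, ht, p_comm, fun a b => ?_, ?_, ?_, fun a b => ?_, sq, qq, tq,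
    fun a b hab => ?_, ?_⟩
  · rcases eq_or_ne a b with rfl | hab
    · rfl
    refine forall_ne_of_conj (Q := fun a b => q a * q b = q b * q a) q_comm ?_ a b hab
    intro c a b h
    simpa only [map_mul, fq] using congrArg (involutionConj (s c) (hss c)) h
  · refine forall_of_conj q_p_comm fun c a h => ?_
    simpa only [map_mul, fq, fp] using congrArg (involutionConj (s c) (hss c)) h
  · refine forall_of_conj t_p_comm fun c a h => ?_
    simpa only [map_mul, ft, fp] using congrArg (involutionConj (s c) (hss c)) h
  · rcases eq_or_ne a b with rfl | hab
    · rw [tq, qt]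
    refine forall_ne_of_conj (Q := fun a b => t a * q b = q b * t a) t_q_comm ?_ a b hab
    intro c a b h
    simpa only [map_mul, ft, fq] using congrArg (involutionConj (s c) (hss c)) h
  · refine forall_ne_of_conj (Q := fun b a => p a * q b * p a = p a) p_q_p ?_ b a hab.symm
    intro c a b h
    simpa only [map_mul, fp, fq] using congrArg (involutionConj (s c) (hss c)) h
  · refine forall_ne_of_conj (Q := fun a b => q a * p b * q a = q a) q_p_q ?_
    intro c a b h
    simpa only [map_mul, fp, fq] using congrArg (involutionConj (s c) (hss c)) h

end Build

section Rewrite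

variable {M : Type*} [Monoid M] {p q s t : Fin 3 → M} (S : ThreeStrands p q s t)

include S

lemma ss (a : Fin 3) (x : M) : s a * (s a * x) = x := by
  rw [← mul_assoc, S.s_mul_s, one_mul]

lemma sp (a b c : Fin 3) (h : a + b + c = 0 := by decide) (x : M) :
    s a * (p b * x) = p c * (s a * x) := by
  obtain rfl : c = -a - b := by revert h; decide +revert
  rw [← mul_assoc, S.s_mul_p, mul_assoc]

lemma sq (a b c : Fin 3) (h : a + b + c = 0 := by decide) (x : M) :
    s a * (q b * x) = q c * (s a * x) := by
  obtain rfl : c = -a - b := by revert h; decide +revert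
  rw [← mul_assoc, S.s_mul_q, mul_assoc]

lemma ss' (a b c : Fin 3) (h : a + b + c = 0 := by decide) (x : M) :
    s a * (s b * x) = s c * (s a * x) := by
  obtain rfl : c = -a - b := by revert h; decide +revert
  rw [← mul_assoc, S.s_mul_s', mul_assoc]

lemma st (a b c : Fin 3) (h : a + b + c = 0 := by decide) (x : M) :
    s a * (t b * x) = t c * (s a * x) := by
  obtain rfl : c = -a - b := by revert h; decide +revert
  rw [← mul_assoc, S.s_mul_t, mul_assoc]

lemma pp (a b : Fin 3) (x : M) : p a * (p b * x) = p b * (p a * x) := by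
  rw [← mul_assoc, S.p_comm, mul_assoc]

lemma qp (a : Fin 3) (x : M) : q a * (p a * x) = p a * (q a * x) := by
  rw [← mul_assoc, S.q_p_comm, mul_assoc]

lemma tp (a : Fin 3) (x : M) : t a * (p a * x) = p a * (t a * x) := by
  rw [← mul_assoc, S.t_p_comm, mul_assoc]

lemma tq (a b : Fin 3) (x : M) : t a * (q b * x) = q b * (t a * x) := by
  rw [← mul_assoc, S.t_q_comm, mul_assoc]

lemma sq_self (a : Fin 3) (x : M) : s a * (q a * x) = q a * x := by
  rw [← mul_assoc, S.s_mul_q_self]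

lemma qs_self (a : Fin 3) (x : M) : q a * (s a * x) = q a * x := by
  have h := S.sq a a a (by decide +revert) x
  rw [← h, S.sq_self]

lemma qq (a : Fin 3) (x : M) : q a * (q a * x) = q a * x := by
  rw [← mul_assoc, S.q_mul_q]

lemma tq_self (a : Fin 3) (x : M) : t a * (q a * x) = q a * x := by
  rw [← mul_assoc, S.t_mul_q]

lemma qt_self (a : Fin 3) (x : M) : q a * (t a * x) = q a * x := by
  rw [← S.tq, S.tq_self]

lemma pqp (a b : Fin 3) (h : a ≠ b := by decide) (x : M) :
    p a * (q b * (p a * x)) = p a * x := by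
  rw [← mul_assoc, ← mul_assoc, S.p_q_p a b h]

lemma qpq (a b : Fin 3) (h : a ≠ b := by decide) (x : M) :
    q a * (p b * (q a * x)) = q a * x := by
  rw [← mul_assoc, ← mul_assoc, S.q_p_q a b h]

lemma qq_comm (a b : Fin 3) (x : M) : q a * (q b * x) = q b * (q a * x) := by
  rw [← mul_assoc, S.q_comm, mul_assoc]

lemma qq_rotate (a b c : Fin 3) (h : a + b + c = 0) (x : M) :
    q a * (q b * x) = q c * (q a * x) := by
  rw [← S.qs_self a, S.sq a b c h, S.qq_comm, S.qs_self]

lemma qq' (a b c d : Fin 3) (hab : a ≠ b := by decide) (hcd : c ≠ d := by decide) (x : M) :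
    q a * (q b * x) = q c * (q d * x) := by
  have h : ∀ a b : Fin 3, a ≠ b → q a * (q b * x) = q 2 * (q 0 * x) := by
    intro a b hab
    have h₁ := S.qq_rotate 2 0 1 rfl x
    have h₂ := S.qq_rotate 0 2 1 rfl x
    have h₃ := S.qq_comm 0 2 x
    have h₄ := S.qq_comm 0 1 x
    have h₅ := S.qq_comm 2 1 x
    revert hab
    fin_cases a <;> fin_cases b <;> intro hab <;>
      first | exact absurd rfl hab | rfl | simp_all
  rw [h a b hab, h c d hcd]

lemma pqp' (a b c : Fin 3) (h : a + b + c = 0 := by decide) (hab : a ≠ b := by decide) (x : M) :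
    p a * (q c * (p b * x)) = p a * (s c * x) := by
  rw [← S.qs_self, S.sp c b a (by revert h; decide +revert),
    S.pqp a c (by revert h hab; decide +revert)]

lemma qps (a b c : Fin 3) (h : a + b + c = 0 := by decide) (x : M) :
    q c * (p a * (s c * x)) = q c * (p b * x) := by
  rw [← S.sp c b a (by revert h; decide +revert), S.qs_self]

lemma spq (a b c : Fin 3) (h : a + b + c = 0 := by decide) (x : M) :
    s c * (p a * (q c * x)) = p b * (q c * x) := by
  rw [S.sp c a b (by revert h; decide +revert), S.sq_self]

lemma tq_swap (a b c : Fin 3) (h : a + b + c = 0 := by decide) (x : M) :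
    t a * (q c * x) = q c * (t b * x) := by
  rw [S.tq, ← S.qs_self, S.st c a b (by revert h; decide +revert), ← S.tq, S.qs_self, S.tq]

lemma qt_swap (a b c : Fin 3) (h : a + b + c = 0 := by decide) (x : M) :
    q c * (t a * x) = q c * (t b * x) := by
  rw [← S.tq, S.tq_swap a b c h]

lemma tq_swap' (a b c : Fin 3) (h : a + b + c = 0 := by decide) (x : M) :
    t a * (q c * x) = t b * (q c * x) := by
  rw [S.tq_swap a b c h, S.tq]

end Rewrite

section Ring

variable {A : Type*} [Ring A] {p q s t : Fin 3 → A}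

/-- The transposition-like element on the last two of three strands obtained from the ones on
the first two. -/
def nextT (p q t : Fin 3 → A) : A :=
  t 0 * (1 - q 2 - q 1 + q 1 * p 0 * q 2 + q 2 * p 0 * q 1)

variable (S : ThreeStrands p q s t)

include S

lemma nextT_mul_q : nextT p q t * q 0 = q 0 := by
  refine eq_of_forall_mul_eq fun x => ?_
  simp only [nextT, add_mul, sub_mul, mul_add, mul_sub, mul_assoc, mul_one]
  have e1 : t 0 * (q 0 * x) = q 0 * x := by
    conv_lhs => rw [S.tq_self 0]
  have e2 : t 0 * (q 2 * (q 0 * x)) = q 2 * (q 0 * x) := by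
    conv_lhs => rw [S.tq 0 2, S.tq_self 0]
  have e3 : t 0 * (q 1 * (q 0 * x)) = q 2 * (q 0 * x) := by
    conv_lhs => rw [S.tq_swap' 0 2 1, S.qq' 1 0 2 0, S.tq_self 2]
  have e4 : t 0 * (q 1 * (p 0 * (q 2 * (q 0 * x)))) = q 2 * (q 0 * x) := by
    conv_lhs => rw [← S.qq' 1 0 2 0, S.qpq 1 0, S.tq_swap' 0 2 1, S.qq' 1 0 2 0, S.tq_self 2]
  have e5 : t 0 * (q 2 * (p 0 * (q 1 * (q 0 * x)))) = q 2 * (q 0 * x) := by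
    conv_lhs => rw [S.qq' 1 0 2 0, S.qpq 2 0, S.tq 0 2, S.tq_self 0]
  linear_combination (norm := abel) e1 - e2 - e3 + e4 + e5

lemma q_mul_nextT : q 0 * nextT p q t = q 0 := by
  refine eq_of_forall_mul_eq fun x => ?_
  simp only [nextT, add_mul, sub_mul, mul_add, mul_sub, mul_assoc, mul_one]
  have e1 : q 0 * (t 0 * x) = q 0 * x := by
    conv_lhs => rw [S.qt_self 0]
  have e2 : q 0 * (t 0 * (q 2 * x)) = q 2 * (q 0 * x) := by
    conv_lhs => rw [S.qt_self 0, S.qq' 0 2 2 0]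
  have e3 : q 0 * (t 0 * (q 1 * x)) = q 2 * (q 0 * x) := by
    conv_lhs => rw [S.qt_self 0, S.qq' 0 1 2 0]
  have e4 : q 0 * (t 0 * (q 1 * (p 0 * (q 2 * x)))) = q 2 * (q 0 * x) := by
    conv_lhs => rw [S.qt_self 0, S.qq' 0 1 0 2, S.qpq 2 0, S.qq' 0 2 2 0]
  have e5 : q 0 * (t 0 * (q 2 * (p 0 * (q 1 * x)))) = q 2 * (q 0 * x) := by
    conv_lhs => rw [S.qt_self 0, ← S.qq' 0 1 0 2, S.qpq 1 0, S.qq' 0 1 2 0]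
  linear_combination (norm := abel) e1 - e2 - e3 + e4 + e5

lemma nextT_mul_s : nextT p q t * s 0 = s 0 * nextT p q t := by
  refine eq_of_forall_mul_eq fun x => ?_
  simp only [nextT, add_mul, sub_mul, mul_add, mul_sub, mul_assoc, mul_one]
  have e1 : t 0 * (s 0 * x) = s 0 * (t 0 * x) := by
    conv_lhs => rw [← S.st 0 0 0]
  have e2 : t 0 * (q 2 * (s 0 * x)) = s 0 * (t 0 * (q 1 * x)) := by
    conv_lhs => rw [← S.sq 0 1 2, ← S.st 0 0 0]
  have e3 : t 0 * (q 1 * (s 0 * x)) = s 0 * (t 0 * (q 2 * x)) := by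
    conv_lhs => rw [← S.sq 0 2 1, ← S.st 0 0 0]
  have e4 : t 0 * (q 1 * (p 0 * (q 2 * (s 0 * x)))) =
      s 0 * (t 0 * (q 2 * (p 0 * (q 1 * x)))) := by
    conv_lhs => rw [← S.sq 0 1 2, ← S.sp 0 0 0, ← S.sq 0 2 1, ← S.st 0 0 0]
  have e5 : t 0 * (q 2 * (p 0 * (q 1 * (s 0 * x)))) =
      s 0 * (t 0 * (q 1 * (p 0 * (q 2 * x)))) := by
    conv_lhs => rw [← S.sq 0 2 1, ← S.sp 0 0 0, ← S.sq 0 1 2, ← S.st 0 0 0]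
  linear_combination (norm := abel) e1 - e2 - e3 + e4 + e5

lemma nextT_eq {l : A} (hl : l * q 2 = t 2 * p 0 * q 2)
    (hl' : q 2 * l = q 2 * p 0 * t 2) :
    s 0 * (s 2 * s 0 * (s 2 * t 2) * s 0 * s 2 + s 0 * q 2 * l * s 0 * q 2 * s 0
      + q 2 * l * s 0 * q 2 - s 0 * q 2 * l * s 2 * q 0 * p 1 * q 2
      - q 2 * p 1 * q 0 * s 2 * l * q 2 * s 0) = nextT p q t := by
  refine eq_of_forall_mul_eq fun x => ?_
  have l_q : ∀ y, l * (q 2 * y) = t 2 * (p 0 * (q 2 * y)) := fun y => by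
    rw [← mul_assoc, hl]
    simp only [mul_assoc]
  have q_l : ∀ y, q 2 * (l * y) = q 2 * (p 0 * (t 2 * y)) := fun y => by
    rw [← mul_assoc, hl']
    simp only [mul_assoc]
  simp only [nextT, l_q, q_l, add_mul, sub_mul, mul_add, mul_sub,
    mul_assoc, mul_one]
  have e1 : s 0 * (s 2 * (s 0 * (s 2 * (t 2 * (s 0 * (s 2 * x)))))) = t 0 * x := by
    conv_lhs => rw [S.ss' 0 2 1, S.ss 0, ← S.ss' 2 0 1, S.st 0 2 1, S.st 2 1 0, S.ss 0, S.ss 2]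
  have e2 : s 0 * (s 0 * (q 2 * (p 0 * (t 2 * (s 0 * (q 2 * (s 0 * x))))))) =
      t 0 * (q 2 * (p 0 * (q 1 * x))) := by
    conv_lhs => rw [S.ss 0, S.sq 0 2 1, S.ss 0, ← S.tq_swap' 0 2 1, ← S.tp 0, ← S.tq 0 2]
  have e3 : s 0 * (q 2 * (p 0 * (t 2 * (s 0 * (q 2 * x))))) =
      t 0 * (q 1 * (p 0 * (q 2 * x))) := by
    conv_lhs => rw [S.sq 0 2 1, S.sp 0 0 0, S.st 0 2 1, S.ss 0, ← S.tq_swap' 0 1 2, ← S.tp 0, ←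
      S.tq 0 1]
  have e4 : s 0 * (s 0 * (q 2 * (p 0 * (t 2 * (s 2 * (q 0 * (p 1 * (q 2 * x)))))))) =
      t 0 * (q 2 * x) := by
    conv_lhs => rw [S.ss 0, ← S.st 2 2 2, S.qps 0 1 2, ← S.tq_swap' 1 2 0, ← S.tp 1, S.pqp 1 0, ←
      S.tq_swap 0 1 2, S.qpq 2 1]
  have e5 : s 0 * (q 2 * (p 1 * (q 0 * (s 2 * (t 2 * (p 0 * (q 2 * (s 0 * x)))))))) =
      t 0 * (q 1 * x) := by
    conv_lhs => rw [S.sq 0 2 1, S.spq 1 2 0, S.st 2 2 2, ← S.tq 2 0, ← S.tp 2, ← S.tq_swap 0 2 1,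
      S.spq 0 1 2, ← S.sq 0 1 2, S.qps 1 2 0, S.pqp 2 0, S.qpq 1 2]
  linear_combination (norm := abel) e1 + e2 + e3 - e4 - e5

/-- The Jucys–Murphy element on the first two strands, in terms of the one on the first strand. -/
def nextL (p q s t : Fin 3 → A) (l : A) : A :=
  -(s 2 * l * q 2) - q 2 * l * s 2 + q 2 * l * p 1 * q 2 + s 2 * l * s 2 + s 2 * t 2

lemma nextL_mul_q_mul_p {l : A} (hl : l * q 2 = t 2 * p 0 * q 2)
    (hl' : q 2 * l = q 2 * p 0 * t 2)
    (hs : l * s 0 = s 0 * l) :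
    nextL p q s t l * q 0 * p 1 = nextT p q t * p 1 := by
  refine eq_of_forall_mul_eq fun x => ?_
  have l_q : ∀ y, l * (q 2 * y) = t 2 * (p 0 * (q 2 * y)) := fun y => by
    rw [← mul_assoc, hl]
    simp only [mul_assoc]
  have q_l : ∀ y, q 2 * (l * y) = q 2 * (p 0 * (t 2 * y)) := fun y => by
    rw [← mul_assoc, hl']
    simp only [mul_assoc]
  have l_s : ∀ y, l * (s 0 * y) = s 0 * (l * y) := fun y => by
    rw [← mul_assoc, hs, mul_assoc]
  have sqp : s 2 * (q 0 * (p 1 * x)) = s 0 * (q 2 * (s 0 * (s 2 * (p 1 * x)))) := by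
    conv_rhs => rw [S.sq 0 2 1, S.ss 0, ← S.sq 2 0 1]
  have main : s 2 * (l * (s 2 * (q 0 * (p 1 * x)))) =
      s 2 * (s 0 * (t 2 * (p 0 * (q 2 * (s 0 * (s 2 * (p 1 * x))))))) := by
    rw [sqp, l_s, l_q]
  simp only [nextL, nextT, add_mul, sub_mul, neg_mul, mul_add, mul_sub,
    mul_assoc, mul_one]
  rw [main]
  simp only [l_q, q_l]
  have e1 : s 2 * (t 2 * (p 0 * (q 2 * (q 0 * (p 1 * x))))) = t 0 * (q 1 * (p 1 * x)) := by
    conv_lhs => rw [S.st 2 2 2, S.spq 0 1 2, ← S.qq' 1 0 2 0, ← S.qp 1, S.pqp 1 0, ← S.tq_swap' 0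
      2 1]
  have e2 : q 2 * (p 0 * (t 2 * (s 2 * (q 0 * (p 1 * x))))) = t 0 * (q 2 * (p 1 * x)) := by
    conv_lhs => rw [← S.st 2 2 2, S.qps 0 1 2, ← S.tq_swap' 1 2 0, ← S.tp 1, S.pqp 1 0, ←
      S.tq_swap 0 1 2]
  have e3 : q 2 * (p 0 * (t 2 * (p 1 * (q 2 * (q 0 * (p 1 * x)))))) =
      t 0 * (q 2 * (p 0 * (q 1 * (p 1 * x)))) := by
    conv_lhs => rw [← S.qq' 1 0 2 0, ← S.qp 1, ← S.tq_swap' 0 2 1, S.pqp 1 0, ← S.tp 0, ← S.tq 0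
      2]
  have e4 : s 2 * (s 0 * (t 2 * (p 0 * (q 2 * (s 0 * (s 2 * (p 1 * x))))))) =
      t 0 * (p 1 * x) := by
    conv_lhs => rw [S.st 0 2 1, S.st 2 1 0, S.sp 0 0 0, S.sq 0 2 1, S.ss 0, ← S.sq 2 0 1, ← S.pqp'
      0 1 2, S.spq 0 1 2, S.pqp 1 2, S.pqp 1 0]
  have e5 : s 2 * (t 2 * (q 0 * (p 1 * x))) = t 0 * (q 1 * (p 0 * (q 2 * (p 1 * x)))) := by
    conv_lhs => rw [S.st 2 2 2, S.sq 2 0 1, ← S.tq_swap' 0 2 1, ← S.pqp 1 2, S.spq 1 0 2]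
  linear_combination (norm := abel) -e1 - e2 + e3 + e4 + e5

lemma p_mul_q_mul_nextL {l : A} (hl : l * q 2 = t 2 * p 0 * q 2)
    (hl' : q 2 * l = q 2 * p 0 * t 2)
    (hs : l * s 0 = s 0 * l) :
    p 1 * q 0 * nextL p q s t l = p 1 * nextT p q t := by
  refine eq_of_forall_mul_eq fun x => ?_
  have l_q : ∀ y, l * (q 2 * y) = t 2 * (p 0 * (q 2 * y)) := fun y => by
    rw [← mul_assoc, hl]
    simp only [mul_assoc]
  have q_l : ∀ y, q 2 * (l * y) = q 2 * (p 0 * (t 2 * y)) := fun y => by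
    rw [← mul_assoc, hl']
    simp only [mul_assoc]
  have l_s : ∀ y, l * (s 0 * y) = s 0 * (l * y) := fun y => by
    rw [← mul_assoc, hs, mul_assoc]
  have pqs : ∀ x, p 1 * (q 0 * (s 2 * x)) = p 1 * (s 2 * (s 0 * (q 2 * (s 0 * x)))) := fun x => by
    conv_rhs => rw [S.sq 0 2 1, S.ss 0, S.sq 2 1 0]
  have main : p 1 * (q 0 * (s 2 * (l * (s 2 * x)))) =
      p 1 * (s 2 * (s 0 * (q 2 * (p 0 * (t 2 * (s 0 * (s 2 * x))))))) := by
    rw [pqs, ← l_s, q_l]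
  simp only [nextL, nextT, add_mul, sub_mul, neg_mul, mul_add, mul_sub, mul_neg,
    mul_assoc, mul_one]
  rw [main]
  simp only [l_q, q_l]
  have e1 : p 1 * (q 0 * (s 2 * (t 2 * (p 0 * (q 2 * x))))) = p 1 * (t 0 * (q 2 * x)) := by
    conv_lhs => rw [S.st 2 2 2, ← S.qt_swap 1 2 0, S.spq 0 1 2, S.tp 1, ← S.tq_swap' 0 1 2, S.pqp
      1 0]
  have e2 : p 1 * (q 0 * (q 2 * (p 0 * (t 2 * (s 2 * x))))) = p 1 * (t 0 * (q 1 * x)) := by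
    conv_lhs => rw [← S.st 2 2 2, S.qps 0 1 2, ← S.qq' 0 1 0 2, S.qp 1, ← S.tq_swap 0 2 1, S.pqp 1
      0]
  have e3 : p 1 * (q 0 * (q 2 * (p 0 * (t 2 * (p 1 * (q 2 * x)))))) =
      p 1 * (t 0 * (q 1 * (p 0 * (q 2 * x)))) := by
    conv_lhs => rw [S.qq' 0 2 1 2, ← S.qp 1, S.pqp' 1 0 2, S.qp 1, S.st 2 2 2, S.spq 1 0 2, ←
      S.tq_swap 0 2 1]
  have e4 : p 1 * (s 2 * (s 0 * (q 2 * (p 0 * (t 2 * (s 0 * (s 2 * x))))))) =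
      p 1 * (t 0 * x) := by
    conv_lhs => rw [S.sq 0 2 1, S.sp 0 0 0, S.st 0 2 1, S.ss 0, ← S.st 2 0 1, ← S.pqp' 1 0 2,
      S.pqp 0 1, S.qps 0 1 2, S.pqp 1 2]
  have e5 : p 1 * (q 0 * (s 2 * (t 2 * x))) = p 1 * (t 0 * (q 2 * (p 0 * (q 1 * x)))) := by
    conv_lhs => rw [← S.sq 2 1 0, ← S.pqp' 1 0 2, ← S.tq_swap 0 2 1, ← S.tp 0, ← S.tq 0 2]
  linear_combination (norm := abel) -e1 - e2 + e3 + e4 + e5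

lemma nextL_mul_q {l : A} (hA : nextL p q s t l * q 0 * p 1 = nextT p q t * p 1) :
    nextL p q s t l * q 0 = nextT p q t * p 1 * q 0 := by
  rw [← hA, mul_assoc, mul_assoc, ← mul_assoc (q 0), S.q_p_q 0 1 (by decide)]

lemma q_mul_nextL {l : A} (hA : p 1 * q 0 * nextL p q s t l = p 1 * nextT p q t) :
    q 0 * nextL p q s t l = q 0 * p 1 * nextT p q t := by
  rw [mul_assoc, ← hA, ← mul_assoc, ← mul_assoc, S.q_p_q 0 1 (by decide)]

/-- An expansion of the Jucys–Murphy element on all three strands. -/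
def expandedL (p q s t : Fin 3 → A) (l : A) : A :=
  s 0 * s 2 * l * s 2 * s 0
    - t 1 * p 2 * q 1 - q 1 * p 2 * t 1 + q 1 * p 0 * t 1 * p 2 * q 1 + s 1 * t 1 - t 0 * p 2 * q
      0 + q 1 * p 2 * q 0 * t 2 + q 2 * t 1 * p 2 * q 1 - q 2 * s 1 * t 2 - q 1 * p 0 * q 2 * t 1
      * p 2 * q 1 - q 0 * p 2 * t 0 + q 0 * p 2 * q 1 * t 2 + q 2 * q 1 * p 2 * t 1 - q 2 * p 0 *
      q 0 * p 2 * q 1 * t 2 - q 0 * s 1 * t 1 + q 0 * p 1 * t 0 * p 2 * q 0 - q 0 * p 1 * q 2 * t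
      1 * p 2 * q 1 - q 2 * p 1 * q 1 * p 2 * q 0 * t 2 + q 2 * p 0 * q 0 * p 1 * q 2 * t 1 * p 2
      * q 1 + q 0 * p 1 * q 2 * s 1 * t 2 + s 0 * t 0 - q 1 * s 0 * t 1 - q 2 * s 0 * t 2 + q 2 *
      p 0 * q 1 * s 0 * t 1 + q 1 * p 0 * q 2 * s 0 * t 2

lemma nextL_eq_expandedL {l : A} (hl : l * q 2 = t 2 * p 0 * q 2)
    (hl' : q 2 * l = q 2 * p 0 * t 2)
    (hA : nextL p q s t l * q 0 * p 1 = nextT p q t * p 1)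
    (hA' : p 1 * q 0 * nextL p q s t l = p 1 * nextT p q t) :
    -(s 0 * nextL p q s t l * q 0) - q 0 * nextL p q s t l * s 0
      + q 0 * nextL p q s t l * p 2 * q 0 + s 0 * nextL p q s t l * s 0 + s 0 * nextT p q t =
    expandedL p q s t l := by
  rw [mul_assoc (s 0) (nextL p q s t l) (q 0), S.nextL_mul_q hA, S.q_mul_nextL hA']
  refine eq_of_forall_mul_eq fun x => ?_
  have l_q : ∀ y, l * (q 2 * y) = t 2 * (p 0 * (q 2 * y)) := fun y => by
    rw [← mul_assoc, hl]
    simp only [mul_assoc]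
  have q_l : ∀ y, q 2 * (l * y) = q 2 * (p 0 * (t 2 * y)) := fun y => by
    rw [← mul_assoc, hl']
    simp only [mul_assoc]
  simp only [nextL, nextT, expandedL, l_q, q_l, add_mul, sub_mul, neg_mul, mul_add, mul_sub,
    mul_neg, mul_assoc, mul_one]
  have e1 : s 0 * (s 2 * (t 2 * (p 0 * (q 2 * (s 0 * x))))) = t 1 * (p 2 * (q 1 * x)) := by
    conv_lhs => rw [S.st 2 2 2, S.st 0 2 1, S.spq 0 1 2, ← S.sq 0 1 2, ← S.pqp' 1 2 0, S.spq 1 2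
      0, S.pqp 2 0]
  have e2 : s 0 * (q 2 * (p 0 * (t 2 * (s 2 * (s 0 * x))))) = q 1 * (p 2 * (t 1 * x)) := by
    conv_lhs => rw [← S.st 2 2 2, S.qps 0 1 2, S.sq 0 2 1, ← S.st 0 1 2, ← S.pqp' 1 2 0, S.spq 1 2
      0, S.pqp 2 0]
  have e3 : s 0 * (q 2 * (p 0 * (t 2 * (p 1 * (q 2 * (s 0 * x)))))) =
      q 1 * (p 0 * (t 1 * (p 2 * (q 1 * x)))) := by
    conv_lhs => rw [S.sq 0 2 1, S.sp 0 0 0, S.st 0 2 1, ← S.sq 0 1 2, ← S.pqp' 1 2 0, S.spq 1 2 0,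
      S.pqp 2 0]
  have e4 : s 0 * (s 2 * (t 2 * (s 0 * x))) = s 1 * (t 1 * x) := by
    conv_lhs => rw [S.ss' 0 2 1, S.st 0 2 1, S.ss 0]
  have e5 : s 0 * (t 0 * (p 1 * (q 0 * x))) = t 0 * (p 2 * (q 0 * x)) := by
    conv_lhs => rw [S.st 0 0 0, S.spq 1 2 0]
  have e6 : s 0 * (t 0 * (q 2 * (p 1 * (q 0 * x)))) = q 1 * (p 2 * (q 0 * (t 2 * x))) := by
    conv_lhs => rw [S.tq_swap 0 1 2, S.sq 0 2 1, S.tp 1, S.tq_swap 1 2 0, S.spq 1 2 0]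
  have e7 : s 0 * (t 0 * (q 1 * (p 1 * (q 0 * x)))) = q 2 * (t 1 * (p 2 * (q 1 * x))) := by
    conv_lhs => rw [S.st 0 0 0, S.sq 0 1 2, S.spq 1 2 0, S.qp 2, S.qq' 2 0 2 1, ← S.qp 2,
      S.tq_swap 0 1 2]
  have e8 : s 0 * (t 0 * (q 1 * (p 0 * (q 2 * (p 1 * (q 0 * x)))))) =
      q 2 * (s 1 * (t 2 * x)) := by
    conv_lhs => rw [S.pqp' 0 1 2, S.sq 2 0 1, S.qpq 1 0, S.tq_swap 0 2 1, ← S.st 2 2 2, S.sq 0 1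
      2, ← S.ss' 2 1 0, S.qs_self 2]
  have e9 : s 0 * (t 0 * (q 2 * (p 0 * (q 1 * (p 1 * (q 0 * x)))))) =
      q 1 * (p 0 * (q 2 * (t 1 * (p 2 * (q 1 * x))))) := by
    conv_lhs => rw [S.st 0 0 0, S.sq 0 2 1, S.tq 0 1, S.sp 0 0 0, S.tp 0, S.sq 0 1 2, S.spq 1 2 0,
      S.qp 2, S.qq' 2 0 2 1, ← S.qp 2, S.tq_swap 0 1 2]
  have e10 : q 0 * (p 1 * (t 0 * (s 0 * x))) = q 0 * (p 2 * (t 0 * x)) := by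
    conv_lhs => rw [← S.st 0 0 0, S.qps 1 2 0]
  have e11 : q 0 * (p 1 * (t 0 * (q 2 * (s 0 * x)))) = q 0 * (p 2 * (q 1 * (t 2 * x))) := by
    conv_lhs => rw [S.tq_swap 0 1 2, ← S.st 0 2 1, ← S.sq 0 1 2, S.qps 1 2 0]
  have e12 : q 0 * (p 1 * (t 0 * (q 1 * (s 0 * x)))) = q 2 * (q 1 * (p 2 * (t 1 * x))) := by
    conv_lhs => rw [S.tq_swap 0 2 1, ← S.st 0 1 2, ← S.sq 0 2 1, S.qps 1 2 0, ← S.qp 2, S.qq' 0 2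
      2 1]
  have e13 : q 0 * (p 1 * (t 0 * (q 1 * (p 0 * (q 2 * (s 0 * x)))))) =
      q 2 * (p 0 * (q 0 * (p 2 * (q 1 * (t 2 * x))))) := by
    conv_lhs => rw [S.tq 0 1, ← S.qp 1, S.qq' 0 1 2 0, S.tp 0, ← S.pp 0 1, S.qp 0, S.tq_swap 0 1
      2, ← S.st 0 2 1, ← S.sq 0 1 2, S.qps 1 2 0]
  have e14 : q 0 * (p 1 * (t 0 * (q 2 * (p 0 * (q 1 * (s 0 * x)))))) =
      q 0 * (s 1 * (t 1 * x)) := by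
    conv_lhs => rw [S.tq 0 2, S.tp 0, S.pqp' 1 0 2, S.tq_swap 0 2 1, S.sq 2 1 0, ← S.st 0 1 2, ←
      S.ss' 0 1 2, S.qpq 0 1, S.qs_self 0]
  have e15 : q 0 * (p 1 * (t 0 * (q 2 * (p 2 * (q 0 * x))))) =
      q 0 * (p 1 * (q 2 * (t 1 * (p 2 * (q 1 * x))))) := by
    conv_lhs => rw [S.qp 2, S.qq' 2 0 2 1, ← S.qp 2, S.tq_swap 0 1 2]
  have e16 : q 0 * (p 1 * (t 0 * (q 1 * (p 2 * (q 0 * x))))) =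
      q 2 * (p 1 * (q 1 * (p 2 * (q 0 * (t 2 * x))))) := by
    conv_lhs => rw [S.tq_swap 0 2 1, S.tp 2, S.tq 2 0, ← S.qp 1, S.qq' 0 1 2 1, S.qp 1]
  have e17 : q 0 * (p 1 * (t 0 * (q 1 * (p 0 * (q 2 * (p 2 * (q 0 * x))))))) =
      q 2 * (p 0 * (q 0 * (p 1 * (q 2 * (t 1 * (p 2 * (q 1 * x))))))) := by
    conv_lhs => rw [S.tq 0 1, S.tp 0, S.qp 2, S.qq' 2 0 2 1, ← S.qp 2, S.tq_swap 0 1 2, ← S.qp 1,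
      ← S.pp 0 1, S.qq' 0 1 2 0, S.qp 0]
  have e18 : q 0 * (p 1 * (t 0 * (q 2 * (p 0 * (q 1 * (p 2 * (q 0 * x))))))) =
      q 0 * (p 1 * (q 2 * (s 1 * (t 2 * x)))) := by
    conv_lhs => rw [S.pqp' 0 2 1, S.sq 1 0 2, S.qpq 2 0, S.tq 0 2, ← S.st 1 2 0]
  have e19 : s 0 * (t 0 * (q 2 * x)) = q 1 * (s 0 * (t 1 * x)) := by
    conv_lhs => rw [S.tq_swap 0 1 2, S.sq 0 2 1]
  have e20 : s 0 * (t 0 * (q 1 * x)) = q 2 * (s 0 * (t 2 * x)) := by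
    conv_lhs => rw [S.tq_swap 0 2 1, S.sq 0 1 2]
  have e21 : s 0 * (t 0 * (q 1 * (p 0 * (q 2 * x)))) =
      q 2 * (p 0 * (q 1 * (s 0 * (t 1 * x)))) := by
    conv_lhs => rw [S.tq 0 1, S.sq 0 1 2, S.tp 0, S.tq_swap 0 1 2, S.sp 0 0 0, S.sq 0 2 1]
  have e22 : s 0 * (t 0 * (q 2 * (p 0 * (q 1 * x)))) =
      q 1 * (p 0 * (q 2 * (s 0 * (t 2 * x)))) := by
    conv_lhs => rw [S.tq 0 2, S.sq 0 2 1, S.tp 0, S.tq_swap 0 2 1, S.sp 0 0 0, S.sq 0 1 2]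
  linear_combination (norm := abel) -e1 - e2 + e3 + e4 - e5 + e6 + e7 - e8 - e9 - e10 + e11 + e12
    - e13 - e14 - e15 - e16 + e17 + e18 - e19 - e20 + e21 + e22

lemma expandedL_mul_q {l : A} (h : l * q 0 = q 0 * l) :
    expandedL p q s t l * q 2 = q 2 * expandedL p q s t l := by
  refine eq_of_forall_mul_eq fun x => ?_
  have l_g : ∀ y, l * (q 0 * y) = q 0 * (l * y) := fun y => by
    rw [← mul_assoc, h, mul_assoc]
  have main : s 0 * (s 2 * (l * (s 2 * (s 0 * (q 2 * x))))) =
      q 2 * (s 0 * (s 2 * (l * (s 2 * (s 0 * x))))) := by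
    conv_lhs => rw [S.sq 0 2 1, S.sq 2 1 0, l_g, S.sq 2 0 1, S.sq 0 1 2]
  simp only [expandedL, add_mul, sub_mul, mul_add, mul_sub, mul_assoc]
  have e1 : t 0 * (p 2 * (q 0 * (q 2 * x))) = t 1 * (p 2 * (q 1 * (q 2 * x))) := by
    conv_lhs => rw [S.qq' 0 2 2 0, ← S.qp 2, S.tq_swap' 0 1 2, S.qp 2, ← S.qq' 1 2 2 0]
  have e2 : q 2 * (t 1 * (p 2 * (q 1 * x))) = t 1 * (p 2 * (q 1 * (q 2 * x))) := by
    conv_lhs => rw [← S.tq 1 2, S.qp 2, ← S.qq' 1 2 2 1]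
  have e3 : q 2 * (t 0 * (p 2 * (q 0 * x))) = t 1 * (p 2 * (q 1 * (q 2 * x))) := by
    conv_lhs => rw [← S.tq_swap 1 0 2, S.qp 2, ← S.qq' 1 2 2 0]
  have e4 : q 2 * (q 2 * (t 1 * (p 2 * (q 1 * x)))) = t 1 * (p 2 * (q 1 * (q 2 * x))) := by
    conv_lhs => rw [S.qq 2, ← S.tq 1 2, S.qp 2, ← S.qq' 1 2 2 1]
  have e5 : q 2 * (t 1 * (p 2 * (q 1 * (q 2 * x)))) = t 1 * (p 2 * (q 1 * (q 2 * x))) := by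
    conv_lhs => rw [← S.tq 1 2, S.qp 2, ← S.qq' 1 2 2 1, S.qq 2]
  have e6 : q 0 * (p 2 * (t 0 * (q 2 * x))) = q 1 * (p 2 * (t 1 * (q 2 * x))) := by
    conv_lhs => rw [S.tq_swap 0 1 2, ← S.qp 2, S.qq' 0 2 1 2, S.qp 2, ← S.tq 1 2]
  have e7 : q 2 * (q 1 * (p 2 * (t 1 * x))) = q 1 * (p 2 * (t 1 * (q 2 * x))) := by
    conv_lhs => rw [← S.qq' 1 2 2 1, S.qp 2, ← S.tq 1 2]
  have e8 : q 2 * (q 0 * (p 2 * (t 0 * x))) = q 1 * (p 2 * (t 1 * (q 2 * x))) := by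
    conv_lhs => rw [← S.qq' 1 2 2 0, S.qp 2, ← S.tq_swap 1 0 2]
  have e9 : q 2 * (q 2 * (q 1 * (p 2 * (t 1 * x)))) = q 1 * (p 2 * (t 1 * (q 2 * x))) := by
    conv_lhs => rw [S.qq 2, ← S.qq' 1 2 2 1, S.qp 2, ← S.tq 1 2]
  have e10 : q 2 * (q 1 * (p 2 * (t 1 * (q 2 * x)))) = q 1 * (p 2 * (t 1 * (q 2 * x))) := by
    conv_lhs => rw [← S.qq' 1 2 2 1, S.qp 2, ← S.tq 1 2, S.qq 2]
  have e11 : q 1 * (p 0 * (q 2 * (t 1 * (p 2 * (q 1 * (q 2 * x)))))) =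
      q 1 * (p 0 * (t 1 * (p 2 * (q 1 * (q 2 * x))))) := by
    conv_lhs => rw [← S.tq 1 2, S.qp 2, ← S.qq' 1 2 2 1, S.qq 2]
  have e12 : q 2 * (q 2 * (p 0 * (q 0 * (p 2 * (q 1 * (t 2 * x)))))) =
      q 2 * (q 1 * (p 0 * (t 1 * (p 2 * (q 1 * x))))) := by
    conv_lhs => rw [← S.tq 2 1, ← S.tp 2, ← S.qt_swap 1 2 0, ← S.qp 0, S.qq' 2 0 2 1, S.qq 2]
  have e13 : q 0 * (s 1 * (t 1 * (q 2 * x))) = s 1 * (t 1 * (q 2 * x)) := by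
    conv_lhs => rw [← S.sq 1 2 0, ← S.tq 1 2, S.qq 2]
  have e14 : q 2 * (q 2 * (s 1 * (t 2 * x))) = q 2 * (s 1 * (t 1 * x)) := by
    conv_lhs => rw [S.qq 2, ← S.sq 1 0 2, ← S.qt_swap 1 2 0, S.sq 1 0 2]
  have e15 : q 2 * (s 0 * (t 2 * (q 2 * x))) = q 2 * (s 1 * (t 2 * (q 2 * x))) := by
    conv_lhs => rw [← S.sq_self 2 (x := x), ← S.st 2 2 2, ← S.ss' 2 1 0, S.qs_self 2]
  have e16 : q 2 * (q 1 * (s 0 * (t 1 * x))) = q 2 * (s 1 * (t 2 * (q 2 * x))) := by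
    conv_lhs => rw [← S.sq_self 1, ← S.sq 0 2 1, ← S.tq 1 2, ← S.sq 1 0 2, S.qs_self 0, S.qt_swap
      1 2 0, S.sq 1 0 2]
  have e17 : q 2 * (q 0 * (s 1 * (t 1 * x))) = q 2 * (s 1 * (t 2 * (q 2 * x))) := by
    conv_lhs => rw [← S.sq 1 2 0, ← S.tq_swap 0 1 2, ← S.tq_self 2 (x := x), S.st 1 0 2, S.qt_self
      2]
  have e18 : q 2 * (q 1 * (p 2 * (q 0 * (t 2 * x)))) = q 2 * (s 1 * (t 2 * (q 2 * x))) := by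
    conv_lhs => rw [← S.qq' 1 0 2 1, ← S.sq_self 1, S.qpq 0 2, ← S.qq' 0 2 1 0, S.qt_self 2, ←
      S.tq_self 2, S.sq 1 0 2]
  have e19 : q 2 * (q 0 * (p 2 * (q 1 * (t 2 * x)))) = q 2 * (s 1 * (t 2 * (q 2 * x))) := by
    conv_lhs => rw [← S.qq' 0 1 2 0, S.qpq 1 2, ← S.qs_self 1, S.qq' 0 1 2 0, ← S.sq 1 2 0,
      S.qt_self 2, ← S.tq_self 2 (x := x)]
  have e20 : q 1 * (p 2 * (q 0 * (t 2 * (q 2 * x)))) = q 2 * (s 1 * (t 2 * (q 2 * x))) := by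
    conv_lhs => rw [S.tq_self 2, S.qq' 0 2 1 0, S.qpq 1 2, ← S.sq_self 1, ← S.qq' 0 2 1 0, ←
      S.tq_self 2, S.sq 1 0 2]
  have e21 : q 0 * (p 2 * (q 1 * (t 2 * (q 2 * x)))) = q 2 * (s 1 * (t 2 * (q 2 * x))) := by
    conv_lhs => rw [S.tq_self 2, ← S.qq' 0 1 1 2, ← S.qs_self 1, S.qpq 0 2, S.qq' 0 1 2 0, ← S.sq
      1 2 0, ← S.tq_self 2 (x := x)]
  have e22 : q 2 * (q 1 * (p 0 * (q 2 * (s 0 * (t 2 * x))))) =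
      q 2 * (s 1 * (t 2 * (q 2 * x))) := by
    conv_lhs => rw [← S.qq' 0 2 2 1, S.qpq 2 0, S.qq' 0 2 2 1, ← S.sq_self 1, ← S.sq 0 2 1,
      S.qt_self 2, ← S.tq_self 2 (x := x), S.ss' 1 0 2, S.qs_self 2]
  have e23 : q 2 * (q 0 * (p 1 * (q 2 * (s 1 * (t 2 * x))))) =
      q 2 * (s 1 * (t 2 * (q 2 * x))) := by
    conv_lhs => rw [← S.qq' 0 2 2 0, S.qpq 2 1, S.qq' 0 2 2 0, ← S.sq 1 2 0, S.qt_self 2, ←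
      S.tq_self 2 (x := x)]
  have e24 : q 1 * (p 0 * (q 2 * (s 0 * (t 2 * (q 2 * x))))) =
      q 2 * (s 1 * (t 2 * (q 2 * x))) := by
    conv_lhs => rw [← S.sq_self 1, S.tq_self 2, S.sq 0 2 1, ← S.qq' 1 0 2 1, S.qpq 1 0, S.qs_self
      0, ← S.qq' 0 2 1 0, ← S.tq_self 2, S.sq 1 0 2]
  have e25 : q 0 * (p 1 * (q 2 * (s 1 * (t 2 * (q 2 * x))))) =
      q 2 * (s 1 * (t 2 * (q 2 * x))) := by
    conv_lhs => rw [S.tq_self 2, S.sq 1 2 0, ← S.qq' 0 1 2 0, S.qpq 0 1, S.qq' 0 1 2 0, ← S.sq 1 2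
      0, ← S.tq_self 2 (x := x)]
  have e26 : q 2 * (p 0 * (q 0 * (p 2 * (q 1 * (t 2 * (q 2 * x)))))) =
      q 2 * (s 1 * (t 2 * (q 2 * x))) := by
    conv_lhs => rw [S.tq_self 2, ← S.qq' 0 1 1 2, S.qpq 0 2, ← S.qs_self 1, S.qq' 0 1 2 0, ← S.sq
      1 2 0, ← S.tq_self 2 (x := x), S.qpq 2 0]
  have e27 : q 2 * (p 1 * (q 1 * (p 2 * (q 0 * (t 2 * (q 2 * x)))))) =
      q 2 * (s 1 * (t 2 * (q 2 * x))) := by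
    conv_lhs => rw [← S.sq_self 1, S.tq_self 2, S.qq' 0 2 1 0, S.qpq 1 2, ← S.qq' 0 2 1 0, ←
      S.tq_self 2 (x := x), S.sq 1 0 2, S.qpq 2 1]
  have e28 : q 2 * (q 1 * (p 0 * (q 2 * (t 1 * (p 2 * (q 1 * x)))))) =
      q 2 * (s 1 * (t 2 * (q 2 * x))) := by
    conv_lhs => rw [← S.qq' 1 2 2 1, ← S.sq_self 1, S.qpq 2 0, ← S.qq' 0 1 1 2, S.qt_self 1, S.qpq
      1 2, S.qq' 0 1 0 2, ← S.tq_self 2, S.sq 1 0 2]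
  have e29 : q 2 * (q 0 * (p 1 * (q 2 * (t 1 * (p 2 * (q 1 * x)))))) =
      q 2 * (s 1 * (t 2 * (q 2 * x))) := by
    conv_lhs => rw [← S.qq' 1 2 2 0, ← S.sq_self 1, S.qpq 2 1, ← S.qq' 0 1 1 2, S.qt_self 1, S.qpq
      1 2, S.qq' 0 1 0 2, ← S.tq_self 2, S.sq 1 0 2]
  have e30 : q 0 * (p 1 * (q 2 * (t 1 * (p 2 * (q 1 * (q 2 * x)))))) =
      q 0 * (p 1 * (t 0 * (p 2 * (q 0 * (q 2 * x))))) := by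
    conv_lhs => rw [← S.tq_swap 0 1 2, S.qp 2, ← S.qq' 0 2 2 1, S.qq 2]
  have e31 : q 2 * (q 2 * (p 1 * (q 1 * (p 2 * (q 0 * (t 2 * x)))))) =
      q 2 * (q 0 * (p 1 * (t 0 * (p 2 * (q 0 * x))))) := by
    conv_lhs => rw [← S.tq 2 0, ← S.tp 2, ← S.qt_swap 0 2 1, ← S.qp 1, ← S.qq' 2 0 2 1, S.qq 2]
  have e32 : q 2 * (p 0 * (q 0 * (p 1 * (q 2 * (t 1 * (p 2 * (q 1 * (q 2 * x)))))))) =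
      q 2 * (q 2 * (p 0 * (q 0 * (p 1 * (q 2 * (t 1 * (p 2 * (q 1 * x)))))))) := by
    conv_lhs => rw [S.qq' 1 2 2 1, ← S.qp 2, S.tq 1 2, S.qq 2, ← S.qq 2]
  have e33 : q 1 * (s 0 * (t 1 * (q 2 * x))) = s 0 * (t 0 * (q 2 * x)) := by
    conv_lhs => rw [← S.sq 0 2 1, ← S.tq_swap 0 1 2, S.qq 2]
  have e34 : q 2 * (q 2 * (s 0 * (t 2 * x))) = q 2 * (s 0 * (t 0 * x)) := by
    conv_lhs => rw [S.qq 2, ← S.sq 0 1 2, ← S.qt_swap 0 2 1, S.sq 0 1 2]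
  have e35 : q 2 * (p 0 * (q 1 * (s 0 * (t 1 * (q 2 * x))))) =
      q 2 * (q 2 * (p 0 * (q 1 * (s 0 * (t 1 * x))))) := by
    conv_lhs => rw [← S.qq 2, S.tq 1 2, S.sq 0 2 1, S.qq 1]
  linear_combination (norm := abel) main - e1 + e2 + e3 - e4 + e5 - e6 + e7 + e8 - e9 + e10 - e11
    + e12 - e13 + e14 - e15 + e16 + e17 - e18 - e19 + e20 + e21 - e22 - e23 + e24 + e25 - e26 -
    e27 + e28 + e29 - e30 + e31 + e32 - e33 + e34 + e35

lemma expandedL_mul_s {l : A} (h : l * s 0 = s 0 * l) :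
    expandedL p q s t l * s 2 = s 2 * expandedL p q s t l := by
  refine eq_of_forall_mul_eq fun x => ?_
  have l_g : ∀ y, l * (s 0 * y) = s 0 * (l * y) := fun y => by
    rw [← mul_assoc, h, mul_assoc]
  have main : s 0 * (s 2 * (l * (s 2 * (s 0 * (s 2 * x))))) =
      s 2 * (s 0 * (s 2 * (l * (s 2 * (s 0 * x))))) := by
    have braid : ∀ y, s 2 * (s 0 * (s 2 * y)) = s 0 * (s 2 * (s 0 * y)) := fun y => by
      conv_lhs => rw [S.ss' 0 2 1, S.ss' 2 1 0]
    conv_lhs => rw [braid, l_g, ← braid]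
  simp only [expandedL, add_mul, sub_mul, mul_add, mul_sub, mul_assoc]
  have e1 : s 2 * (t 0 * (p 2 * (q 0 * x))) = t 1 * (p 2 * (q 1 * (s 2 * x))) := by
    conv_lhs => rw [S.st 2 0 1, S.sp 2 2 2, S.sq 2 0 1]
  have e2 : s 2 * (t 1 * (p 2 * (q 1 * x))) = t 0 * (p 2 * (q 0 * (s 2 * x))) := by
    conv_lhs => rw [S.st 2 1 0, S.sp 2 2 2, S.sq 2 1 0]
  have e3 : s 2 * (q 0 * (p 2 * (t 0 * x))) = q 1 * (p 2 * (t 1 * (s 2 * x))) := by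
    conv_lhs => rw [S.sq 2 0 1, S.sp 2 2 2, S.st 2 0 1]
  have e4 : s 2 * (q 1 * (p 2 * (t 1 * x))) = q 0 * (p 2 * (t 0 * (s 2 * x))) := by
    conv_lhs => rw [S.sq 2 1 0, S.sp 2 2 2, S.st 2 1 0]
  have e5 : q 1 * (p 0 * (t 1 * (p 2 * (q 1 * (s 2 * x))))) =
      s 2 * (q 0 * (p 1 * (t 0 * (p 2 * (q 0 * x))))) := by
    conv_lhs => rw [← S.sq 2 0 1, ← S.sp 2 2 2, ← S.st 2 0 1, ← S.sp 2 1 0, ← S.sq 2 0 1]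
  have e6 : q 0 * (p 1 * (t 0 * (p 2 * (q 0 * (s 2 * x))))) =
      s 2 * (q 1 * (p 0 * (t 1 * (p 2 * (q 1 * x))))) := by
    conv_lhs => rw [← S.sq 2 1 0, ← S.sp 2 2 2, ← S.st 2 1 0, ← S.sp 2 0 1, ← S.sq 2 1 0]
  have e7 : s 1 * (t 1 * (s 2 * x)) = s 2 * (s 0 * (t 0 * x)) := by
    conv_lhs => rw [← S.st 2 0 1, ← S.ss' 2 0 1]
  have e8 : s 0 * (t 0 * (s 2 * x)) = s 2 * (s 1 * (t 1 * x)) := by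
    conv_lhs => rw [← S.st 2 1 0, ← S.ss' 2 1 0]
  have e9 : q 1 * (p 2 * (q 0 * (t 2 * (s 2 * x)))) =
      s 2 * (q 0 * (p 2 * (q 1 * (t 2 * x)))) := by
    conv_lhs => rw [← S.st 2 2 2, ← S.sq 2 1 0, ← S.sp 2 2 2, ← S.sq 2 0 1]
  have e10 : q 0 * (p 2 * (q 1 * (t 2 * (s 2 * x)))) =
      s 2 * (q 1 * (p 2 * (q 0 * (t 2 * x)))) := by
    conv_lhs => rw [← S.st 2 2 2, ← S.sq 2 0 1, ← S.sp 2 2 2, ← S.sq 2 1 0]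
  have e11 : q 2 * (t 1 * (p 2 * (q 1 * (s 2 * x)))) =
      s 2 * (q 2 * (t 1 * (p 2 * (q 1 * x)))) := by
    conv_lhs => rw [← S.tq_swap 0 1 2, S.qp 2, ← S.qq' 2 0 2 1, ← S.sq 2 1 0, S.qs_self 2, ← S.qp
      2, S.tq_swap 0 1 2, ← S.sq_self 2]
  have e12 : s 2 * (q 2 * (s 0 * (t 2 * x))) = q 2 * (s 1 * (t 2 * (s 2 * x))) := by
    conv_lhs => rw [S.sq 2 2 2, S.ss' 2 0 1, S.st 2 2 2]
  have e13 : s 2 * (q 2 * (s 1 * (t 2 * x))) = q 2 * (s 0 * (t 2 * (s 2 * x))) := by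
    conv_lhs => rw [S.sq 2 2 2, S.ss' 2 1 0, S.st 2 2 2]
  have e14 : s 2 * (q 0 * (p 1 * (q 2 * (t 1 * (p 2 * (q 1 * x)))))) =
      q 1 * (p 0 * (q 2 * (t 1 * (p 2 * (q 1 * (s 2 * x)))))) := by
    conv_lhs => rw [← S.tq_swap 0 1 2, S.qp 2, ← S.qq' 0 2 2 1, ← S.qs_self 2, S.qq' 0 2 2 1, ←
      S.qp 2, S.tq_swap 0 1 2, S.sq 2 0 1, S.spq 1 0 2]
  have e15 : s 2 * (q 1 * (p 0 * (q 2 * (t 1 * (p 2 * (q 1 * x)))))) =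
      q 0 * (p 1 * (q 2 * (t 1 * (p 2 * (q 1 * (s 2 * x)))))) := by
    conv_lhs => rw [← S.tq_swap 0 1 2, S.qp 2, ← S.qq' 0 2 2 1, ← S.qs_self 2, S.qq' 0 2 2 1, ←
      S.qp 2, S.tq_swap 0 1 2, S.sq 2 1 0, S.spq 0 1 2]
  have e16 : q 2 * (q 1 * (p 2 * (t 1 * (s 2 * x)))) =
      s 2 * (q 2 * (q 1 * (p 2 * (t 1 * x)))) := by
    conv_lhs => rw [← S.qq' 0 2 2 1, S.qp 2, ← S.qt_swap 0 1 2, ← S.st 2 1 0, S.qs_self 2, ← S.qp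
      2, S.qq' 0 2 2 1, ← S.sq_self 2]
  have e17 : s 2 * (q 2 * (p 1 * (q 1 * (p 2 * (q 0 * (t 2 * x)))))) =
      q 2 * (p 0 * (q 0 * (p 2 * (q 1 * (t 2 * (s 2 * x)))))) := by
    conv_lhs => rw [S.sq_self 2, ← S.qps 0 1 2, S.sq 2 1 0, S.sp 2 2 2, S.sq 2 0 1, S.st 2 2 2]
  have e18 : s 2 * (q 2 * (p 0 * (q 0 * (p 2 * (q 1 * (t 2 * x)))))) =
      q 2 * (p 1 * (q 1 * (p 2 * (q 0 * (t 2 * (s 2 * x)))))) := by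
    conv_lhs => rw [S.sq_self 2, ← S.qps 1 0 2, S.sq 2 0 1, S.sp 2 2 2, S.sq 2 1 0, S.st 2 2 2]
  have e19 : s 2 * (q 1 * (s 0 * (t 1 * x))) = q 0 * (s 1 * (t 1 * (s 2 * x))) := by
    conv_lhs => rw [S.sq 2 1 0, S.ss' 2 0 1, ← S.sq 1 2 0, S.st 2 1 0, S.qt_swap 0 1 2, S.sq 1 2
      0]
  have e20 : s 2 * (q 0 * (s 1 * (t 1 * x))) = q 1 * (s 0 * (t 1 * (s 2 * x))) := by
    conv_lhs => rw [S.sq 2 0 1, S.ss' 2 1 0, ← S.sq 0 2 1, S.st 2 1 0, S.qt_swap 0 1 2, S.sq 0 2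
      1]
  have e21 : q 2 * (p 0 * (q 0 * (p 1 * (q 2 * (t 1 * (p 2 * (q 1 * (s 2 * x)))))))) =
      s 2 * (q 2 * (p 0 * (q 0 * (p 1 * (q 2 * (t 1 * (p 2 * (q 1 * x)))))))) := by
    conv_lhs => rw [← S.tq_swap 0 1 2, S.qp 2, ← S.qq' 2 0 2 1, ← S.sq 2 1 0, S.qs_self 2, ← S.qp
      2, S.tq_swap 0 1 2, ← S.sq_self 2]
  have e22 : q 0 * (p 1 * (q 2 * (s 1 * (t 2 * (s 2 * x))))) =
      s 2 * (q 1 * (p 0 * (q 2 * (s 0 * (t 2 * x))))) := by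
    conv_lhs => rw [← S.spq 0 1 2, ← S.sq 2 1 0, ← S.st 2 2 2, ← S.ss' 2 0 1, S.qs_self 2]
  have e23 : q 1 * (p 0 * (q 2 * (s 0 * (t 2 * (s 2 * x))))) =
      s 2 * (q 0 * (p 1 * (q 2 * (s 1 * (t 2 * x))))) := by
    conv_lhs => rw [← S.spq 1 0 2, ← S.sq 2 0 1, ← S.st 2 2 2, ← S.ss' 2 1 0, S.qs_self 2]
  have e24 : q 2 * (p 0 * (q 1 * (s 0 * (t 1 * (s 2 * x))))) =
      s 2 * (q 2 * (p 0 * (q 1 * (s 0 * (t 1 * x))))) := by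
    conv_lhs => rw [← S.sq 0 2 1, ← S.qt_swap 0 1 2, ← S.st 2 1 0, S.qs_self 2, S.sq 0 2 1, ←
      S.sq_self 2]
  linear_combination (norm := abel) main + e1 + e2 + e3 + e4 + e5 + e6 + e7 + e8 + e9 + e10 + e11
    + e12 + e13 + e14 + e15 + e16 + e17 + e18 + e19 + e20 + e21 + e22 + e23 + e24

end Ring

end ThreeStrands

namespace PartitionAlgebra

open ThreeStrands

variable {k : ℕ} {A : Type*} [Ring A] [Algebra (Polynomial ℤ) A] (P : PartitionAlgebra k A)

/-- `L_n` and `σ_n` commute with whatever commutes with the generators on the first `n` strands. -/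
lemma commute_LS {x : A} : ∀ n : ℕ, (∀ j, 1 ≤ j → j ≤ n → Commute (P.p j) x) →
    (∀ j, 1 ≤ j → j < n → Commute (P.s j) x) → (∀ j, 1 ≤ j → j < n → Commute (P.q j) x) →
    Commute (P.LS n).1 x ∧ Commute (P.LS n).2 x
  | 0, _, _, _ => ⟨Commute.zero_left x, Commute.one_left x⟩
  | 1, hp, _, _ => ⟨hp 1 le_rfl le_rfl, Commute.one_left x⟩
  | n + 2, hp, hs, hq => by
    obtain ⟨hL, hσ⟩ := commute_LS (n + 1) (fun j h h' => hp j h (by omega))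
      (fun j h h' => hs j h (by omega)) (fun j h h' => hq j h (by omega))
    obtain ⟨hL', -⟩ := commute_LS n (fun j h h' => hp j h (by omega))
      (fun j h h' => hs j h (by omega)) (fun j h h' => hq j h (by omega))
    have s1 := hs (n + 1) (by omega) (by omega)
    have q1 := hq (n + 1) (by omega) (by omega)
    have p1 := hp (n + 1) (by omega) (by omega)
    have p2 := hp (n + 2) (by omega) (by omega)
    have key : Commute (P.LS (n + 2)).2 x := by
      rcases Nat.eq_zero_or_pos n with rfl | hn
      · exact s1
      have s0 := hs n hn (by omega)
      have q0 := hq n hn (by omega)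
      simp only [LS, if_neg hn.ne']
      exact ((((((s0.mul_left s1).mul_left hσ).mul_left s1).mul_left s0).add_left
        (((((s1.mul_left q0).mul_left hL').mul_left s1).mul_left q0).mul_left s1)).add_left
        (((q0.mul_left hL').mul_left s1).mul_left q0)).sub_left
        ((((((s1.mul_left q0).mul_left hL').mul_left s0).mul_left q1).mul_left p1).mul_left q0)
        |>.sub_left
        ((((((q0.mul_left p1).mul_left q1).mul_left s0).mul_left hL').mul_left q0).mul_left s1)
    refine ⟨?_, key⟩
    exact (((((s1.mul_left hL).mul_left q1).neg_left.sub_left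
      ((q1.mul_left hL).mul_left s1)).add_left
      (((q1.mul_left hL).mul_left p2).mul_left q1)).add_left
      ((s1.mul_left hL).mul_left s1)).add_left key

lemma commute_LS_p {n j : ℕ} (hnj : n < j) (hj : j ≤ k) :
    Commute (P.LS n).1 (P.p j) ∧ Commute (P.LS n).2 (P.p j) :=
  P.commute_LS n (fun m _ _ => P.p_comm m j (by omega) (by omega) (by omega) hj)
    (fun m _ _ => P.s_p m j (by omega) (by omega) (by omega) hj (by omega) (by omega))
    (fun m _ _ => P.q_p m j (by omega) (by omega) (by omega) hj (by omega) (by omega))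

lemma commute_LS_s {n j : ℕ} (hnj : n < j) (hj : j ≤ k - 1) :
    Commute (P.LS n).1 (P.s j) ∧ Commute (P.LS n).2 (P.s j) :=
  P.commute_LS n
    (fun m _ _ => (P.s_p j m (by omega) hj (by omega) (by omega) (by omega) (by omega)).symm)
    (fun m _ _ => P.s_comm m j (by omega) (by omega) (by omega) hj (by omega) (by omega))
    (fun m _ _ => (P.s_q' j m (by omega) hj (by omega) (by omega) (by omega) (by omega)).symm)

lemma commute_LS_q {n j : ℕ} (hnj : n < j) (hj : j ≤ k - 1) :
    Commute (P.LS n).1 (P.q j) ∧ Commute (P.LS n).2 (P.q j) :=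
  P.commute_LS n
    (fun m _ _ => (P.q_p j m (by omega) hj (by omega) (by omega) (by omega) (by omega)).symm)
    (fun m _ _ => P.s_q' m j (by omega) (by omega) (by omega) hj (by omega) (by omega))
    (fun m _ _ => P.q_comm m j (by omega) (by omega) (by omega) hj)

/-- The element `s_i σ_{i+1}`. -/
def tau (i : ℕ) : A := P.s i * P.sig (i + 1)

lemma s_mul_tau {i : ℕ} (hi : 1 ≤ i) (hik : i ≤ k - 1) : P.s i * P.tau i = P.sig (i + 1) := by
  rw [tau, ← mul_assoc, P.s_sq i hi hik, one_mul]

lemma tau_one (hk : 1 ≤ k - 1) : P.tau 1 = 1 := P.s_sq 1 le_rfl hk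

lemma sig_succ {i : ℕ} (hi : 1 ≤ i) (hik : i ≤ k - 1) :
    P.sig (i + 2) = P.s i * P.s (i + 1) * (P.s i * P.tau i) * P.s (i + 1) * P.s i
      + P.s (i + 1) * P.q i * P.L i * P.s (i + 1) * P.q i * P.s (i + 1)
      + P.q i * P.L i * P.s (i + 1) * P.q i
      - P.s (i + 1) * P.q i * P.L i * P.s i * P.q (i + 1) * P.p (i + 1) * P.q i
      - P.q i * P.p (i + 1) * P.q (i + 1) * P.s i * P.L i * P.q i * P.s (i + 1) := by
  rw [P.s_mul_tau hi hik]
  simp only [sig, L, LS, if_neg (Nat.one_le_iff_ne_zero.mp hi)]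

lemma L_succ {i : ℕ} (hi : 1 ≤ i) (hik : i ≤ k - 1) :
    P.L (i + 1) = -(P.s i * P.L i * P.q i) - P.q i * P.L i * P.s i
      + P.q i * P.L i * P.p (i + 1) * P.q i + P.s i * P.L i * P.s i + P.s i * P.tau i := by
  rw [P.s_mul_tau hi hik]
  obtain ⟨n, rfl⟩ := Nat.exists_eq_add_of_le' hi
  rfl

/-- The relations satisfied by `s_i σ_{i+1}`. -/
structure TauRelations (i : ℕ) : Prop where
  mul_s : P.tau i * P.s i = P.s i * P.tau i
  mul_q : P.tau i * P.q i = P.q i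
  q_mul : P.q i * P.tau i = P.q i
  mul_p : P.L i * P.q i * P.p i = P.tau i * P.p i
  p_mul : P.p i * P.q i * P.L i = P.p i * P.tau i
  mul_q_succ : i + 1 ≤ k - 1 → P.tau i * P.q (i + 1) = P.q (i + 1) * P.tau i

/-- The generators `p` on three consecutive strands. -/
def strandP (i : ℕ) : Fin 3 → A := ![P.p i, P.p (i + 1), P.p (i + 2)]

/-- The elements `p_{j+1/2}` and their conjugate on three consecutive strands. -/
def strandQ (i : ℕ) : Fin 3 → A := ![P.q (i + 1), P.s (i + 1) * P.q i * P.s (i + 1), P.q i]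

/-- The transpositions on three consecutive strands. -/
def strandS (i : ℕ) : Fin 3 → A := ![P.s (i + 1), P.s i * P.s (i + 1) * P.s i, P.s i]

/-- The element `s_i σ_{i+1}` and its conjugates on three consecutive strands. -/
def strandT (i : ℕ) : Fin 3 → A :=
  ![P.s i * (P.s (i + 1) * P.tau i * P.s (i + 1)) * P.s i,
    P.s (i + 1) * P.tau i * P.s (i + 1), P.tau i]

variable {P}

namespace TauRelations

lemma one (hk : 1 ≤ k - 1) : P.TauRelations 1 := by
  have e : P.L 1 = P.p 1 := rfl
  constructor <;> simp only [P.tau_one hk, one_mul, mul_one, implies_true, e]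
  · exact P.pqp₂ 1 le_rfl hk
  · exact P.pqp₂ 1 le_rfl hk

variable {i : ℕ} (H : P.TauRelations i) (hi : 1 ≤ i) (hik : i + 1 ≤ k - 1)

include hi hik

omit H in
lemma tau_p : Commute (P.tau i) (P.p (i + 2)) :=
  Commute.mul_left (P.s_p i (i + 2) hi (by omega) (by omega) (by omega) (by omega) (by omega))
    (P.commute_LS_p (by omega) (by omega)).2

include H

lemma threeStrands :
    ThreeStrands (P.strandP i) (P.strandQ i) (P.strandS i) (P.strandT i) := by
  have hik' : i ≤ k - 1 := by omega
  refine of_base (P.s_sq (i + 1) (by omega) hik) (P.s_sq i hi hik') rfl (P.braid i hi hik)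
    (P.sps i hi hik').symm (P.sps (i + 1) (by omega) hik).symm
    (P.s_p (i + 1) i (by omega) hik hi (by omega) (by omega) (by omega))
    (P.s_p i (i + 2) hi hik' (by omega) (by omega) (by omega) (by omega))
    (P.s_q i hi hik') (P.q_s i hi hik') (P.s_q (i + 1) (by omega) hik)
    (P.q_s (i + 1) (by omega) hik) rfl (P.sqs (i + 1) (by omega) hik) H.mul_s.symm rfl rfl
    ?_ (P.q_comm i (i + 1) hi hik' (by omega) hik)
    (P.q_p i (i + 2) hi hik' (by omega) (by omega) (by omega) (by omega))
    (tau_p hi hik) (H.mul_q_succ hik) (P.q_sq i hi hik') H.mul_q H.q_mul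
    (P.pqp₂ i hi hik') (P.qpq₁ i hi hik')
  intro a b
  fin_cases a <;> fin_cases b <;> exact P.p_comm _ _ (by omega) (by omega) (by omega) (by omega)

lemma L_mul_q : P.L i * P.q i = P.tau i * P.p i * P.q i := by
  rw [← H.mul_p, mul_assoc, mul_assoc, ← mul_assoc (P.q i), P.qpq₁ i hi (by omega)]

lemma q_mul_L : P.q i * P.L i = P.q i * P.p i * P.tau i := by
  rw [mul_assoc, ← H.p_mul, ← mul_assoc, ← mul_assoc, P.qpq₁ i hi (by omega)]

lemma tau_succ : P.tau (i + 1) = nextT (P.strandP i) (P.strandQ i) (P.strandT i) := by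
  rw [tau, P.sig_succ hi (by omega)]
  exact (H.threeStrands hi hik).nextT_eq (H.L_mul_q hi hik) (H.q_mul_L hi hik)

omit H in
lemma L_succ_eq : P.L (i + 1) =
    nextL (P.strandP i) (P.strandQ i) (P.strandS i) (P.strandT i) (P.L i) :=
  P.L_succ hi (by omega)

lemma mul_p_succ :
    P.L (i + 1) * P.q (i + 1) * P.p (i + 1) = P.tau (i + 1) * P.p (i + 1) := by
  rw [L_succ_eq hi hik, H.tau_succ hi hik]
  exact (H.threeStrands hi hik).nextL_mul_q_mul_p (H.L_mul_q hi hik) (H.q_mul_L hi hik)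
    (P.commute_LS_s (by omega) hik).1

lemma p_mul_succ :
    P.p (i + 1) * P.q (i + 1) * P.L (i + 1) = P.p (i + 1) * P.tau (i + 1) := by
  rw [L_succ_eq hi hik, H.tau_succ hi hik]
  exact (H.threeStrands hi hik).p_mul_q_mul_nextL (H.L_mul_q hi hik) (H.q_mul_L hi hik)
    (P.commute_LS_s (by omega) hik).1

lemma tau_succ_q (hik' : i + 2 ≤ k - 1) : Commute (P.tau (i + 1)) (P.q (i + 2)) := by
  have si : Commute (P.s i) (P.q (i + 2)) :=
    P.s_q' i (i + 2) hi (by omega) (by omega) hik' (by omega) (by omega)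
  have qi : Commute (P.q i) (P.q (i + 2)) :=
    P.q_comm i (i + 2) hi (by omega) (by omega) hik'
  have qi' : Commute (P.q (i + 1)) (P.q (i + 2)) :=
    P.q_comm (i + 1) (i + 2) (by omega) (by omega) (by omega) hik'
  have pi : Commute (P.p i) (P.q (i + 2)) :=
    (P.q_p (i + 2) i (by omega) hik' hi (by omega) (by omega) (by omega)).symm
  have tq : Commute (P.tau i) (P.q (i + 1)) := H.mul_q_succ hik
  have ts : Commute (P.tau i) (P.s (i + 2)) := Commute.mul_left
    (P.s_comm i (i + 2) hi (by omega) (by omega) hik' (by omega) (by omega))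
    (P.commute_LS_s (by omega) hik').2
  have q1 : Commute (P.s (i + 1) * P.q i * P.s (i + 1)) (P.q (i + 2)) := by
    have e := P.sqs (i + 1) (by omega) hik
    rw [Nat.add_sub_cancel] at e
    rw [e]
    exact (si.mul_left qi').mul_left si
  have t1 : Commute (P.s (i + 1) * P.tau i * P.s (i + 1)) (P.q (i + 2)) := by
    have s1 := P.s_sq (i + 1) (by omega) hik
    have s2 := P.s_sq (i + 2) (by omega) hik'
    have e := P.sqs (i + 2) (by omega) hik'
    rw [show i + 2 - 1 = i + 1 from rfl] at e
    have hq : P.q (i + 2) =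
        P.s (i + 1) * (P.s (i + 2) * P.q (i + 1) * P.s (i + 2)) * P.s (i + 1) := by
      rw [e]
      simp only [← mul_assoc, s1, one_mul]
      rw [mul_assoc, s1, mul_one]
    have hc : Commute (P.tau i) (P.s (i + 2) * P.q (i + 1) * P.s (i + 2)) :=
      (ts.mul_right tq).mul_right ts
    have s1' : ∀ y, P.s (i + 1) * (P.s (i + 1) * y) = y := fun y => by
      rw [← mul_assoc, s1, one_mul]
    rw [hq]
    generalize P.s (i + 2) * P.q (i + 1) * P.s (i + 2) = Q at hc
    change _ * _ = _ * _
    simp only [mul_assoc, s1']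
    rw [← mul_assoc (P.tau i), hc.eq, mul_assoc]
  rw [H.tau_succ hi hik]
  have t0 : Commute (P.strandT i 0) (P.q (i + 2)) := (si.mul_left t1).mul_left si
  exact t0.mul_left (((((Commute.one_left _).sub_left qi).sub_left q1).add_left
    ((q1.mul_left pi).mul_left qi)).add_left ((qi.mul_left pi).mul_left q1))

lemma succ : P.TauRelations (i + 1) where
  mul_s := by
    rw [H.tau_succ hi hik]
    exact (H.threeStrands hi hik).nextT_mul_s
  mul_q := by
    rw [H.tau_succ hi hik]
    exact (H.threeStrands hi hik).nextT_mul_q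
  q_mul := by
    rw [H.tau_succ hi hik]
    exact (H.threeStrands hi hik).q_mul_nextT
  mul_p := H.mul_p_succ hi hik
  p_mul := H.p_mul_succ hi hik
  mul_q_succ h := H.tau_succ_q hi hik h

lemma L_eq_expandedL : P.L (i + 2) =
    expandedL (P.strandP i) (P.strandQ i) (P.strandS i) (P.strandT i) (P.L i) := by
  have S := H.threeStrands hi hik
  rw [P.L_succ (i := i + 1) (by omega) hik, H.tau_succ hi hik, L_succ_eq hi hik]
  exact S.nextL_eq_expandedL (H.L_mul_q hi hik) (H.q_mul_L hi hik)
    (S.nextL_mul_q_mul_p (H.L_mul_q hi hik) (H.q_mul_L hi hik) (P.commute_LS_s (by omega) hik).1)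
    (S.p_mul_q_mul_nextL (H.L_mul_q hi hik) (H.q_mul_L hi hik) (P.commute_LS_s (by omega) hik).1)

lemma L_comm_q : P.L (i + 2) * P.q i = P.q i * P.L (i + 2) := by
  rw [H.L_eq_expandedL hi hik]
  exact (H.threeStrands hi hik).expandedL_mul_q (P.commute_LS_q (by omega) hik).1

lemma L_comm_s : P.L (i + 2) * P.s i = P.s i * P.L (i + 2) := by
  rw [H.L_eq_expandedL hi hik]
  exact (H.threeStrands hi hik).expandedL_mul_s (P.commute_LS_s (by omega) hik).1

end TauRelations

lemma tauRelations {i : ℕ} (hi : 1 ≤ i) (hik : i ≤ k - 1) : P.TauRelations i := by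
  induction i, hi using Nat.le_induction with
  | base => exact .one hik
  | succ i hi ih => exact (ih (by omega)).succ hi hik

lemma L_comm_p {i : ℕ} (hi : 1 ≤ i) (hik : i ≤ k - 1) :
    P.L (i + 1) * P.p i = P.p i * P.L (i + 1) := by
  have H := P.tauRelations hi hik
  have ss := P.s_sq i hi hik
  have sp : P.s i * P.p i = P.p (i + 1) * P.s i := by
    rw [← P.sps i hi hik, mul_assoc (P.s i * P.p i), ss, mul_one]
  have ps : P.p i * P.s i = P.s i * P.p (i + 1) := by
    rw [← P.sps i hi hik, mul_assoc (P.s i), ← mul_assoc (P.s i) (P.s i), ss, one_mul]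
  have Lp : P.L i * P.p (i + 1) = P.p (i + 1) * P.L i :=
    (P.commute_LS_p (by omega) (by omega)).1
  have pqp : P.p (i + 1) * P.q i * P.p i = P.p (i + 1) * P.s i := by
    rw [← P.q_s i hi hik, mul_assoc, mul_assoc, sp, ← mul_assoc (P.q i), ← mul_assoc, ← mul_assoc,
      show P.p (i + 1) * P.q i * P.p (i + 1) = P.p (i + 1) from
        P.pqp₁ (i + 1) (by omega) (by omega)]
  have pqp' : P.p i * P.q i * P.p (i + 1) = P.p i * P.s i := by
    rw [← P.q_s i hi hik, mul_assoc, mul_assoc, ← ps, ← mul_assoc (P.q i), ← mul_assoc,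
      ← mul_assoc, P.pqp₂ i hi hik]
  have hLp := H.mul_p
  have hpL := H.p_mul
  have hts := H.mul_s
  simp only [mul_assoc] at pqp pqp' hLp
  have right : P.L (i + 1) * P.p i = P.s i * (P.L i * (P.p (i + 1) * P.s i)) := by
    rw [P.L_succ hi hik]
    simp only [add_mul, sub_mul, neg_mul, mul_assoc, sp, pqp, hLp]
    abel
  have left : P.p i * P.L (i + 1) = P.p i * P.s i * P.L i * P.s i := by
    have h : P.p i * P.tau i * P.p (i + 1) * P.q i = P.p i * P.s i * P.L i * P.q i := by
      rw [← hpL, mul_assoc (P.p i * P.q i), Lp, ← mul_assoc, mul_assoc (P.p i), pqp']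
    rw [P.L_succ hi hik]
    simp only [mul_add, mul_sub, mul_neg, ← mul_assoc, h, hpL]
    rw [mul_assoc (P.p i) (P.tau i), hts, ← mul_assoc]
    abel
  rw [right, left, ps, mul_assoc (P.s i), ← Lp]
  simp only [mul_assoc]

end PartitionAlgebra

/-- Theorem 3.7(2)–(5): `L_{i+1}` commutes with `p_i` for `1 ≤ i ≤ k-1`, and with
`p_{i-1/2}`, `s_{i-1}`, `p_{i-1}` for `2 ≤ i ≤ k-1`. -/
theorem partitionAlgebra_L_comm {k : ℕ} {A : Type*} [Ring A]
    [Algebra (Polynomial ℤ) A] (P : PartitionAlgebra k A) :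
    (∀ i, 1 ≤ i → i ≤ k - 1 → P.L (i + 1) * P.p i = P.p i * P.L (i + 1)) ∧
    (∀ i, 2 ≤ i → i ≤ k - 1 →
      P.L (i + 1) * P.q (i - 1) = P.q (i - 1) * P.L (i + 1) ∧
      P.L (i + 1) * P.s (i - 1) = P.s (i - 1) * P.L (i + 1) ∧
      P.L (i + 1) * P.p (i - 1) = P.p (i - 1) * P.L (i + 1)) := by
  refine ⟨fun i hi hik => P.L_comm_p hi hik, fun i hi hik => ?_⟩
  obtain ⟨j, rfl⟩ := Nat.exists_eq_add_of_le' hi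
  have hj : j + 1 + 1 ≤ k - 1 := hik
  have H : P.TauRelations (j + 1) := P.tauRelations (by omega) (by omega)
  have hs := H.L_comm_s (by omega) hik
  have hp : P.p (j + 1) = P.s (j + 1) * P.p (j + 2) * P.s (j + 1) := by
    have ss := P.s_sq (j + 1) (by omega) (by omega)
    rw [← P.sps (j + 1) (by omega) (by omega)]
    simp only [← mul_assoc, ss, one_mul]
    rw [mul_assoc, ss, mul_one]
  refine ⟨H.L_comm_q (by omega) hik, hs, ?_⟩
  change P.L (j + 1 + 2) * P.p (j + 1) = P.p (j + 1) * P.L (j + 1 + 2)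
  rw [hp]
  exact ((Commute.mul_right hs (P.L_comm_p (by omega) hik)).mul_right hs).eq
end
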